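/- arXiv:1405.0810 — 2 statements merged into one kernel-verified Lean document; each statement's English description precedes it below -/
import Mathlib

section
/- Let s ∈ (1/2, 1]. There exists a constant C, depending only on s, such that for every irrational x ∈ (0,1) with continued fraction convergents (p_j/q_j)_{j≥1}, every index j, and all integers N, M with q_j/4 ≤ N < M ≤ q_{j+1}/4: |F_{s,M}(x) − F_{s,N}(x)| ≤ C (|θ_0(p_j/q_j)| δ_j √(q_{j+1}/(q_j q_{j+1})^s) + (1 + log q_j) q_j^{1/2−s}), where θ_0(p_j/q_j) = q_j^{−1/2} Σ_{b=0}^{q_j−1} e^{2πi p_j b²/q_j}. -/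
open MeasureTheory Filter Set
open scoped Real BigOperators ENNReal

/-- Partial sum `F_{s,N}(x) = ∑_{n=1}^N n^{-s} e^{2πi n² x}`. -/
noncomputable def FsN (s : ℝ) (N : ℕ) (x : ℝ) : ℂ :=
  ∑ n ∈ Finset.Icc 1 N,
    (((n : ℝ) ^ (-s) : ℝ) : ℂ) * Complex.exp (2 * Real.pi * Complex.I * (n : ℂ) ^ 2 * (x : ℂ))

/-- Iterates of the Gauss map: `cfX x 0 = x`, `cfX x (j+1) = frac (1 / cfX x j)`. -/
noncomputable def cfX (x : ℝ) : ℕ → ℝ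
  | 0 => x
  | j + 1 => Int.fract (cfX x j)⁻¹

/-- Partial quotients: `cfA x j = a_{j+1} = ⌊1 / x_j⌋`. -/
noncomputable def cfA (x : ℝ) (j : ℕ) : ℤ := ⌊(cfX x j)⁻¹⌋

/-- Numerators of the convergents of x ∈ (0,1): `p_0 = 0`, `p_1 = 1`,
`p_{j+2} = a_{j+2} p_{j+1} + p_j`. -/
noncomputable def cfP (x : ℝ) : ℕ → ℤ
  | 0 => 0
  | 1 => 1
  | j + 2 => cfA x (j + 1) * cfP x (j + 1) + cfP x j

/-- Denominators of the convergents of x ∈ (0,1): `q_0 = 1`, `q_1 = a_1`,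
`q_{j+2} = a_{j+2} q_{j+1} + q_j`. -/
noncomputable def cfQ (x : ℝ) : ℕ → ℤ
  | 0 => 1
  | 1 => cfA x 0
  | j + 2 => cfA x (j + 1) * cfQ x (j + 1) + cfQ x j

/-- `h_j = x - p_j/q_j`. -/
noncomputable def cfH (x : ℝ) (j : ℕ) : ℝ := x - (cfP x j : ℝ) / (cfQ x j : ℝ)

/-- `r_j`, defined by `|h_j| = q_j^{-r_j}`, i.e. `r_j = -log_{q_j} |h_j|`. -/
noncomputable def cfR (x : ℝ) (j : ℕ) : ℝ := -Real.logb (cfQ x j : ℝ) |cfH x j|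

/-- The filter of large indices `j ≥ 1` whose convergent denominator `q_j` is not
twice an odd number (i.e. `q_j ≢ 2 [MOD 4]`). -/
def oddFilter (x : ℝ) : Filter ℕ :=
  Filter.atTop ⊓ Filter.principal {j : ℕ | 1 ≤ j ∧ cfQ x j % 4 ≠ 2}

/-- The approximation rate `r_odd(x) ∈ [2,∞]`: the limsup of the `r_j` over indices `j`
with `q_j ≢ 2 [MOD 4]`. -/
noncomputable def rOdd (x : ℝ) : ℝ≥0∞ :=
  Filter.limsup (fun j => ENNReal.ofReal (cfR x j)) (oddFilter x)

/-- `δ_j`: equal to `1` when `s < 1`, and to `log (q_{j+1}/q_j)` when `s = 1`. -/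
noncomputable def deltaJ (s x : ℝ) (j : ℕ) : ℝ :=
  if s < 1 then 1 else Real.log ((cfQ x (j + 1) : ℝ) / (cfQ x j : ℝ))

/-- The summand `δ_j √(q_{j+1} / (q_j q_{j+1})^s)`. -/
noncomputable def sigTerm (s x : ℝ) (j : ℕ) : ℝ :=
  deltaJ s x j *
    Real.sqrt ((cfQ x (j + 1) : ℝ) / ((cfQ x j : ℝ) * (cfQ x (j + 1) : ℝ)) ^ s)

/-- `Σ_s(x) = ∑_{j ≥ 1, q_j ≢ 2 (4)} δ_j √(q_{j+1}/(q_j q_{j+1})^s)`, valued in `[0,∞]`. -/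
noncomputable def SigmaS (s x : ℝ) : ℝ≥0∞ :=
  ∑' j : ℕ, if 1 ≤ j ∧ cfQ x j % 4 ≠ 2 then ENNReal.ofReal (sigTerm s x j) else 0

/-- The Gauss sum `τ_m = ∑_{b=0}^{q-1} e^{2πi (p b² + m b)/q}`. -/
noncomputable def gaussTau (p : ℤ) (q : ℕ) (m : ℤ) : ℂ :=
  ∑ b ∈ Finset.range q,
    Complex.exp (2 * Real.pi * Complex.I * ((p : ℂ) * (b : ℂ) ^ 2 + (m : ℂ) * (b : ℂ)) / (q : ℂ))

/-- `θ_m = τ_m / √q`. -/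
noncomputable def gaussTheta (p : ℤ) (q : ℕ) (m : ℤ) : ℂ :=
  gaussTau p q m / (Real.sqrt q : ℂ)

noncomputable def ee (t : ℝ) : ℂ := Complex.exp (2 * Real.pi * Complex.I * (t : ℂ))

lemma ee_add (a b : ℝ) : ee (a + b) = ee a * ee b := by
  unfold ee; rw [← Complex.exp_add]; congr 1; push_cast; ring

lemma ee_norm (a : ℝ) : ‖ee a‖ = 1 := by
  unfold ee
  rw [show (2 * Real.pi * Complex.I * (a : ℂ)) = ((2 * Real.pi * a : ℝ) : ℂ) * Complex.I by
    push_cast; ring]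
  exact Complex.norm_exp_ofReal_mul_I _

lemma ee_neg_mul (a : ℝ) : ee (-a) * ee a = 1 := by
  rw [← ee_add]; simp [ee]

lemma ee_sub_one_norm (t : ℝ) : ‖ee t - 1‖ = 2 * |Real.sin (Real.pi * t)| := by
  have := Complex.norm_exp_I_mul_ofReal_sub_one (2 * Real.pi * t)
  unfold ee
  rw [show (2 * Real.pi * Complex.I * (t : ℂ)) = Complex.I * ((2 * Real.pi * t : ℝ) : ℂ) by
    push_cast; ring, this, norm_mul]
  simp only [Real.norm_eq_abs]
  rw [abs_of_pos (by norm_num : (0 : ℝ) < 2)]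
  congr 3; ring

lemma ee_sub_norm (a b : ℝ) : ‖ee a - ee b‖ ≤ 2 * Real.pi * |a - b| := by
  have h1 : ee a - ee b = ee b * (ee (a - b) - 1) := by
    rw [mul_sub, ← ee_add]; simp
  rw [h1, norm_mul, ee_norm, one_mul, ee_sub_one_norm]
  have : |Real.sin (Real.pi * (a - b))| ≤ |Real.pi * (a - b)| := Real.abs_sin_le_abs
  rw [abs_mul, abs_of_pos Real.pi_pos] at this
  linarith

lemma one_sub_ee_norm (t l : ℝ) (h1 : l ≤ |t|) (h2 : |t| ≤ 1 - l) (hl : 0 < l) :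
    4 * l ≤ ‖1 - ee t‖ := by
  rw [norm_sub_rev, ee_sub_one_norm]
  have h3 : |Real.sin (Real.pi * t)| = Real.sin (Real.pi * |t|) := by
    rcases abs_cases t with ⟨h, h'⟩ | ⟨h, h'⟩
    · rw [h, abs_of_nonneg]
      apply Real.sin_nonneg_of_nonneg_of_le_pi
      · positivity
      · nlinarith [Real.pi_pos]
    · rw [h, mul_neg, Real.sin_neg, abs_of_nonpos]
      apply Real.sin_nonpos_of_nonpos_of_neg_pi_le
      · nlinarith [Real.pi_pos]
      · nlinarith [Real.pi_pos]
  rw [h3]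
  have hpi := Real.pi_pos
  rcases le_total (|t|) (1/2) with h | h
  · have := Real.mul_le_sin (x := Real.pi * |t|) (by positivity) (by nlinarith)
    rw [show 2 / Real.pi * (Real.pi * |t|) = 2 * |t| by field_simp] at this
    linarith
  · have := Real.mul_le_sin (x := Real.pi * (1 - |t|)) (by apply mul_nonneg <;> linarith) (by nlinarith)
    rw [show 2 / Real.pi * (Real.pi * (1 - |t|)) = 2 * (1 - |t|) by field_simp,
      show Real.pi * (1 - |t|) = Real.pi - Real.pi * |t| by ring, Real.sin_pi_sub] at this
    linarith

lemma abel_id (a c : ℕ → ℂ) (N K : ℕ) :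
    ∑ n ∈ Finset.Ico N (N + K + 1), c n * (a (n+1) - a n) =
      c (N+K) * a (N + K + 1) - c N * a N - ∑ n ∈ Finset.Ico N (N + K), (c (n+1) - c n) * a (n+1) := by
  induction K with
  | zero => simp; ring
  | succ K ih =>
    rw [← add_assoc, Finset.sum_Ico_succ_top (by omega), ih, Finset.sum_Ico_succ_top (by omega)]
    ring

/-- Kusmin–Landau type bound for quadratic phases. -/
lemma quad_phase (h θ : ℝ) (N K : ℕ) (μ : ℕ → ℝ)
    (hμ : ∀ n ∈ Finset.Ico N (N + K + 1), 0 < μ n ∧ μ n ≤ |h * (2 * n + 1) - θ| ∧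
      |h * (2 * n + 1) - θ| ≤ 1 - μ n) :
    ‖∑ n ∈ Finset.Ico N (N + K + 1), ee (h * ((n + 1 : ℕ) : ℝ) ^ 2 - θ * ((n + 1 : ℕ) : ℝ))‖ ≤
      1 / (4 * μ N) + 1 / (4 * μ (N + K)) +
        ∑ n ∈ Finset.Ico N (N + K), Real.pi * |h| / (4 * μ n * μ (n+1)) := by
  set a : ℕ → ℂ := fun n => ee (h * (n : ℝ) ^ 2 - θ * (n : ℝ)) with ha
  set D : ℕ → ℝ := fun n => h * (2 * n + 1) - θ with hD
  set c : ℕ → ℂ := fun n => 1 / (1 - ee (- D n)) with hc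
  have hb : ∀ n ∈ Finset.Ico N (N + K + 1), 4 * μ n ≤ ‖1 - ee (- D n)‖ := by
    intro n hn
    obtain ⟨h1, h2, h3⟩ := hμ n hn
    apply one_sub_ee_norm _ _ _ _ h1 <;> rw [abs_neg] <;> assumption
  have hne : ∀ n ∈ Finset.Ico N (N + K + 1), 1 - ee (- D n) ≠ 0 := by
    intro n hn h0
    have := hb n hn
    rw [h0, norm_zero] at this
    linarith [(hμ n hn).1]
  have hcn : ∀ n ∈ Finset.Ico N (N + K + 1), ‖c n‖ ≤ 1 / (4 * μ n) := by
    intro n hn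
    simp only [hc, norm_div, norm_one]
    exact one_div_le_one_div_of_le (by linarith [(hμ n hn).1]) (hb n hn)
  have hstep : ∀ n ∈ Finset.Ico N (N + K + 1), a (n+1) = c n * (a (n+1) - a n) := by
    intro n hn
    have e1 : a n = ee (- D n) * a (n+1) := by
      simp only [ha, hD, ← ee_add]; congr 1; push_cast; ring
    rw [e1]
    simp only [hc]
    have := hne n hn
    field_simp
  have hsum : ∑ n ∈ Finset.Ico N (N + K + 1), ee (h * ((n + 1 : ℕ) : ℝ) ^ 2 - θ * ((n + 1 : ℕ) : ℝ)) =
      ∑ n ∈ Finset.Ico N (N + K + 1), c n * (a (n+1) - a n) := Finset.sum_congr rfl hstep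
  rw [hsum, abel_id]
  have han : ∀ n, ‖a n‖ = 1 := fun n => ee_norm _
  have hdiff : ∀ n ∈ Finset.Ico N (N + K), ‖(c (n+1) - c n) * a (n+1)‖ ≤
      Real.pi * |h| / (4 * μ n * μ (n+1)) := by
    intro n hn
    rw [Finset.mem_Ico] at hn
    have m1 : n ∈ Finset.Ico N (N + K + 1) := by rw [Finset.mem_Ico]; omega
    have m2 : n + 1 ∈ Finset.Ico N (N + K + 1) := by rw [Finset.mem_Ico]; omega
    rw [norm_mul, han, mul_one]
    have e : c (n+1) - c n = (ee (- D (n+1)) - ee (- D n)) * (c n * c (n+1)) := by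
      have := hne n m1
      have := hne _ m2
      simp only [hc]; field_simp; ring
    have p1 := (hμ n m1).1
    have p2 := (hμ _ m2).1
    rw [e, norm_mul, norm_mul]
    calc _ ≤ (2 * Real.pi * |(- D (n+1)) - (- D n)|) * (1 / (4 * μ n) * (1 / (4 * μ (n+1)))) := by
          have := hcn n m1
          have := hcn _ m2
          have := ee_sub_norm (- D (n+1)) (- D n)
          gcongr
      _ = _ := by
          have : (- D (n+1)) - (- D n) = -(2 * h) := by simp only [hD]; push_cast; ring
          rw [this, abs_neg, abs_mul, abs_of_pos (by norm_num : (0:ℝ) < 2)]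
          field_simp; ring
  have m1 : N ∈ Finset.Ico N (N + K + 1) := by rw [Finset.mem_Ico]; omega
  have m2 : N + K ∈ Finset.Ico N (N + K + 1) := by rw [Finset.mem_Ico]; omega
  calc _ ≤ ‖c (N+K) * a (N+K+1)‖ + ‖c N * a N‖ + ‖∑ n ∈ Finset.Ico N (N + K), (c (n+1) - c n) * a (n+1)‖ := by
        refine (norm_sub_le _ _).trans ?_
        gcongr
        exact norm_sub_le _ _
    _ ≤ 1 / (4 * μ (N+K)) + 1 / (4 * μ N) + ∑ n ∈ Finset.Ico N (N + K), Real.pi * |h| / (4 * μ n * μ (n+1)) := by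
        rw [norm_mul, norm_mul, han, han, mul_one, mul_one]
        have := hcn _ m1
        have := hcn _ m2
        gcongr
        exact norm_sum_le_of_le _ hdiff
    _ = _ := by ring

/-- Abel's inequality with decreasing weights. -/
lemma abel_ineq (a : ℕ → ℂ) (w : ℕ → ℝ) (N : ℕ) (B : ℝ) (K : ℕ)
    (hw : ∀ n, N ≤ n → w (n+1) ≤ w n) (hw0 : ∀ n, N ≤ n → 0 ≤ w n)
    (hB : ∀ k, k ≤ K → ‖∑ n ∈ Finset.Ico N (N + k), a n‖ ≤ B) :
    ‖∑ n ∈ Finset.Ico N (N + K), (w n : ℂ) * a n‖ ≤ w N * B := by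
  have hid : ∀ k, ∑ n ∈ Finset.Ico N (N + k), (w n : ℂ) * a n =
      (w (N + k) : ℂ) * ∑ n ∈ Finset.Ico N (N + k), a n +
      ∑ i ∈ Finset.range k, ((w (N + i) - w (N + i + 1) : ℝ) : ℂ) * ∑ n ∈ Finset.Ico N (N + i + 1), a n := by
    intro k
    induction k with
    | zero => simp
    | succ k ih =>
      rw [← add_assoc, Finset.sum_Ico_succ_top (by omega), ih, Finset.sum_range_succ,
        Finset.sum_Ico_succ_top (by omega)]
      push_cast; ring
  rw [hid]
  have h0 : ∑ i ∈ Finset.range K, (w (N + i) - w (N + i + 1)) = w N - w (N + K) := by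
    have := Finset.sum_range_sub' (fun i => w (N + i)) K
    simpa [add_assoc] using this
  calc _ ≤ w (N + K) * B + ∑ i ∈ Finset.range K, (w (N + i) - w (N + i + 1)) * B := by
        refine (norm_add_le _ _).trans ?_
        gcongr
        · rw [norm_mul, Complex.norm_real, Real.norm_of_nonneg (hw0 _ (by omega))]
          exact mul_le_mul_of_nonneg_left (hB K le_rfl) (hw0 _ (by omega))
        · refine norm_sum_le_of_le _ fun i hi => ?_
          rw [Finset.mem_range] at hi
          have := hw (N + i) (by omega)
          rw [norm_mul, Complex.norm_real, Real.norm_of_nonneg (by linarith)]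
          exact mul_le_mul_of_nonneg_left (hB (i+1) (by omega)) (by linarith)
    _ = w N * B := by rw [← Finset.sum_mul, h0]; ring

lemma sum_inv_le_log (N K : ℕ) (hN : 1 ≤ N) :
    ∑ n ∈ Finset.Ico N (N + K), ((n + 1 : ℕ) : ℝ)⁻¹ ≤ Real.log ((N + K : ℕ) / N) := by
  have hN' : (0:ℝ) < N := by exact_mod_cast hN
  induction K with
  | zero => simp [hN'.ne']
  | succ K ih =>
    rw [← add_assoc, Finset.sum_Ico_succ_top (by omega)]
    have h1 : (0:ℝ) < (N + K : ℕ) := by exact_mod_cast (by omega : 0 < N + K)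
    have h2 : (0:ℝ) < (N + K + 1 : ℕ) := by positivity
    have := Real.log_le_sub_one_of_pos (div_pos h1 h2)
    rw [Real.log_div h1.ne' h2.ne'] at this
    rw [Real.log_div h1.ne' hN'.ne'] at ih
    rw [Real.log_div h2.ne' hN'.ne']
    have e : ((N + K : ℕ) : ℝ) / (N + K + 1 : ℕ) - 1 = - ((N + K + 1 : ℕ) : ℝ)⁻¹ := by
      push_cast; push_cast at h2; field_simp; ring
    linarith

lemma sum_rpow_le (s : ℝ) (hs0 : 0 < s) (hs : s < 1) (N K : ℕ) :
    ∑ n ∈ Finset.Ico N (N + K), ((n + 1 : ℕ) : ℝ) ^ (-s) ≤ ((N + K : ℕ) : ℝ) ^ (1 - s) / (1 - s) := by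
  induction K with
  | zero =>
    simp only [add_zero, Finset.Ico_self, Finset.sum_empty]
    have : 0 < 1 - s := by linarith
    positivity
  | succ K ih =>
    rw [← add_assoc, Finset.sum_Ico_succ_top (by omega)]
    have h3 : 0 < 1 - s := by linarith
    set n := N + K
    have h2 : (0:ℝ) < (n + 1 : ℕ) := by positivity
    have hb := rpow_one_add_le_one_add_mul_self (s := - ((n + 1 : ℕ) : ℝ)⁻¹) (p := 1 - s)
      (by
        have : ((n + 1 : ℕ) : ℝ)⁻¹ ≤ 1 := inv_le_one_of_one_le₀ (by push_cast; linarith [(Nat.cast_nonneg n : (0:ℝ) ≤ n)])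
        linarith) h3.le (by linarith)
    have e1 : 1 + - ((n + 1 : ℕ) : ℝ)⁻¹ = n / (n + 1 : ℕ) := by
      push_cast; push_cast at h2; field_simp; ring
    rw [e1, Real.div_rpow (by positivity) h2.le, div_le_iff₀ (by positivity)] at hb
    have e2 : ((n + 1 : ℕ) : ℝ) ^ (-s) = ((n + 1 : ℕ) : ℝ)⁻¹ * ((n + 1 : ℕ) : ℝ) ^ (1 - s) := by
      rw [← Real.rpow_neg_one, ← Real.rpow_add h2]; congr 1; ring
    rw [le_div_iff₀ h3] at ih ⊢
    rw [add_mul, e2]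
    nlinarith

lemma card_two_torsion (q : ℕ) [NeZero q] :
    (Finset.univ.filter (fun d : ZMod q => 2 * d = 0)).card ≤ 2 := by
  have hsub : (Finset.univ.filter (fun d : ZMod q => 2 * d = 0)).image ZMod.val ⊆ {0, q / 2} := by
    intro v hv
    simp only [Finset.mem_image, Finset.mem_filter, Finset.mem_univ, true_and] at hv
    obtain ⟨d, hd, rfl⟩ := hv
    have h1 : ((2 * d.val : ℕ) : ZMod q) = 0 := by
      push_cast; rw [ZMod.natCast_zmod_val]; exact hd
    rw [ZMod.natCast_eq_zero_iff] at h1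
    have := ZMod.val_lt d
    obtain ⟨k, hk⟩ := h1
    have : k < 2 := by
      by_contra hk2
      push Not at hk2
      have : q * 2 ≤ q * k := Nat.mul_le_mul_left _ hk2
      omega
    simp only [Finset.mem_insert, Finset.mem_singleton]
    interval_cases k <;> omega
  calc _ = ((Finset.univ.filter (fun d : ZMod q => 2 * d = 0)).image ZMod.val).card :=
        (Finset.card_image_of_injective _ (ZMod.val_injective q)).symm
    _ ≤ ({0, q/2} : Finset ℕ).card := Finset.card_le_card hsub
    _ ≤ 2 := Finset.card_le_two

noncomputable def TT (q : ℕ) [NeZero q] (p m : ZMod q) : ℂ :=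
  ∑ b : ZMod q, ZMod.stdAddChar (p * b ^ 2 + m * b)

lemma TT_norm (q : ℕ) [NeZero q] (p m : ZMod q) (hp : IsUnit p) :
    ‖TT q p m‖ ≤ Real.sqrt (2 * q) := by
  apply Real.le_sqrt_of_sq_le
  have hprim := ZMod.isPrimitive_stdAddChar q
  have h1 : TT q p m * (starRingEnd ℂ) (TT q p m) =
      ∑ d : ZMod q, ZMod.stdAddChar (p * d ^ 2 + m * d) * (if 2 * d = 0 then (q : ℂ) else 0) := by
    unfold TT
    rw [map_sum, Finset.sum_mul_sum, Finset.sum_comm]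
    have : ∀ c : ZMod q, ∑ b : ZMod q, ZMod.stdAddChar (p * b ^ 2 + m * b) *
        (starRingEnd ℂ) (ZMod.stdAddChar (p * c ^ 2 + m * c)) =
        ∑ d : ZMod q, ZMod.stdAddChar (p * d ^ 2 + m * d) * ZMod.stdAddChar (c * (2 * p * d)) := by
      intro c
      rw [← Equiv.sum_comp (Equiv.addLeft c)]
      refine Finset.sum_congr rfl fun d _ => ?_
      rw [← AddChar.map_neg_eq_conj, ← AddChar.map_add_eq_mul, ← AddChar.map_add_eq_mul]
      congr 1
      simp only [Equiv.coe_addLeft]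
      ring
    rw [Finset.sum_congr rfl (fun c _ => this c), Finset.sum_comm]
    refine Finset.sum_congr rfl fun d _ => ?_
    rw [← Finset.mul_sum, AddChar.sum_mulShift _ hprim]
    congr 1
    have : 2 * p * d = 0 ↔ 2 * d = 0 := by
      rw [show 2 * p * d = p * (2 * d) by ring]
      exact hp.mul_right_eq_zero
    simp only [this, ZMod.card]
    split_ifs <;> simp
  have h2 : ‖TT q p m‖ ^ 2 = ‖TT q p m * (starRingEnd ℂ) (TT q p m)‖ := by
    rw [norm_mul, RCLike.norm_conj]; ring
  rw [h2, h1]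
  calc _ ≤ ∑ d : ZMod q, (if 2 * d = 0 then (q : ℝ) else 0) := by
        refine norm_sum_le_of_le _ fun d _ => ?_
        rw [norm_mul, AddChar.norm_apply, one_mul]
        split_ifs <;> simp
    _ = ((Finset.univ.filter (fun d : ZMod q => 2 * d = 0)).card : ℝ) * q := by
        rw [← Finset.sum_filter, Finset.sum_const, nsmul_eq_mul]
    _ ≤ 2 * q := by
        gcongr
        exact_mod_cast card_two_torsion q

lemma TT_inv (q : ℕ) [NeZero q] (p n : ZMod q) :
    ∑ m : ZMod q, TT q p m * ZMod.stdAddChar (- (m * n)) = q * ZMod.stdAddChar (p * n ^ 2) := by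
  have hprim := ZMod.isPrimitive_stdAddChar q
  unfold TT
  simp_rw [Finset.sum_mul]
  rw [Finset.sum_comm]
  have : ∀ b : ZMod q, ∑ m : ZMod q, ZMod.stdAddChar (p * b ^ 2 + m * b) * ZMod.stdAddChar (- (m * n))
      = ZMod.stdAddChar (p * b ^ 2) * (if b = n then (q : ℂ) else 0) := by
    intro b
    have := AddChar.sum_mulShift (b - n) hprim
    rw [show (if b = n then (q : ℂ) else 0) = ∑ m : ZMod q, ZMod.stdAddChar (m * (b - n)) by
      rw [this]; simp only [sub_eq_zero, ZMod.card]; split_ifs <;> simp, Finset.mul_sum]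
    refine Finset.sum_congr rfl fun m _ => ?_
    rw [← AddChar.map_add_eq_mul, ← AddChar.map_add_eq_mul]
    congr 1; ring
  rw [Finset.sum_congr rfl (fun b _ => this b)]
  simp [mul_comm]

lemma sum_zmod_val {E : Type*} [AddCommMonoid E] (q : ℕ) [NeZero q] (f : ℕ → E) :
    ∑ m : ZMod q, f m.val = ∑ i ∈ Finset.range q, f i := by
  obtain ⟨k, rfl⟩ : ∃ k, q = k + 1 := ⟨q - 1, by have := NeZero.pos q; omega⟩
  exact Fin.sum_univ_eq_sum_range f (k + 1)

lemma sum_recip (q : ℕ) (hq : 1 ≤ q) :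
    ∑ i ∈ Finset.range q, ((i : ℝ)⁻¹ + ((q : ℝ) - i)⁻¹) ≤ 2 * (1 + Real.log q) := by
  have hH : ((harmonic q : ℚ) : ℝ) ≤ 1 + Real.log q := harmonic_le_one_add_log q
  have hHe : ((harmonic q : ℚ) : ℝ) = ∑ i ∈ Finset.range q, ((i : ℝ) + 1)⁻¹ := by
    unfold harmonic; push_cast; rfl
  rw [Finset.sum_add_distrib]
  have h2 : ∑ i ∈ Finset.range q, ((q : ℝ) - i)⁻¹ = ∑ i ∈ Finset.range q, ((i : ℝ) + 1)⁻¹ := by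
    rw [← Finset.sum_range_reflect]
    refine Finset.sum_congr rfl fun i hi => ?_
    rw [Finset.mem_range] at hi
    congr 1
    rw [Nat.cast_sub (by omega), Nat.cast_sub (by omega)]; push_cast; ring
  have h1 : ∑ i ∈ Finset.range q, ((i : ℝ))⁻¹ ≤ ∑ i ∈ Finset.range q, ((i : ℝ) + 1)⁻¹ := by
    obtain ⟨k, rfl⟩ : ∃ k, q = k + 1 := ⟨q - 1, by omega⟩
    rw [Finset.sum_range_succ', Finset.sum_range_succ]
    push_cast
    simp only [inv_zero]
    have : (0:ℝ) ≤ ((k:ℝ)+1)⁻¹ := by positivity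
    linarith
  linarith

lemma phase_nonzero (h : ℝ) (q m M N K : ℕ) (hm : 1 ≤ m) (hmq : m < q)
    (hh : |h| * (4 * M) * q ≤ 1) (hNM : N + K ≤ M) :
    ‖∑ n ∈ Finset.Ico N (N + K), ee (h * ((n + 1 : ℕ) : ℝ) ^ 2 - ((m : ℝ) / q) * ((n + 1 : ℕ) : ℝ))‖ ≤
      2 * q * ((m : ℝ)⁻¹ + ((q : ℝ) - m)⁻¹) := by
  have hm1 : (1:ℝ) ≤ m := by exact_mod_cast hm
  have hmq1 : (m:ℝ) + 1 ≤ q := by exact_mod_cast hmq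
  have hq0 : (0:ℝ) < q := by linarith
  have hqm : (0:ℝ) < q - m := by linarith
  rcases K with _ | k
  · simp only [add_zero, Finset.Ico_self, Finset.sum_empty, norm_zero]
    positivity
  obtain ⟨d, hd1, hdm, hdq, hdr⟩ : ∃ d : ℝ, 1 ≤ d ∧ d ≤ m ∧ d ≤ q - m ∧
      d⁻¹ ≤ (m : ℝ)⁻¹ + ((q : ℝ) - m)⁻¹ := by
    refine ⟨min m (q - m), le_min hm1 (by linarith), min_le_left _ _, min_le_right _ _, ?_⟩
    have i1 : (0:ℝ) < (m:ℝ)⁻¹ := by positivity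
    have i2 : (0:ℝ) < ((q:ℝ) - m)⁻¹ := by positivity
    rcases min_choice (m : ℝ) (q - m) with h | h <;> rw [h] <;> linarith
  have hd0 : 0 < d := by linarith
  have key := quad_phase h ((m : ℝ) / q) N k (fun _ => d / (2 * q)) (by
    intro n hn
    rw [Finset.mem_Ico] at hn
    have hn' : (2 * (n:ℝ) + 1) ≤ 2 * M := by exact_mod_cast (by omega : 2 * n + 1 ≤ 2 * M)
    have hb : |h * (2 * n + 1)| ≤ 1 / (2 * q) := by
      rw [abs_mul, abs_of_pos (by positivity : (0:ℝ) < 2 * n + 1), le_div_iff₀ (by positivity)]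
      have := mul_le_mul_of_nonneg_left hn' (abs_nonneg h)
      nlinarith
    obtain ⟨b1, b2⟩ := abs_le.1 hb
    have e1 : d / (2 * q) ≤ (m:ℝ) / q - 1 / (2 * q) := by
      rw [div_le_iff₀ (by positivity)]; field_simp; linarith
    have e2 : (m:ℝ) / q + 1 / (2 * q) ≤ 1 - d / (2 * q) := by
      field_simp; linarith
    have hneg : h * (2 * n + 1) - (m:ℝ) / q ≤ 0 := by
      have : 0 < d / (2 * q) := by positivity
      linarith
    rw [abs_of_nonpos hneg]
    refine ⟨by positivity, by linarith, by linarith⟩)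
  rw [← add_assoc]
  refine key.trans ?_
  rw [Finset.sum_const, Nat.card_Ico, nsmul_eq_mul]
  have hk : ((N + k - N : ℕ) : ℝ) ≤ M := by exact_mod_cast (by omega : N + k - N ≤ M)
  have hpi := Real.pi_lt_four
  have hpi0 := Real.pi_pos
  have h2 : ((N + k - N : ℕ) : ℝ) * (Real.pi * |h| / (4 * (d / (2 * q)) * (d / (2 * q)))) ≤ q / d := by
    have e : Real.pi * |h| / (4 * (d / (2 * q)) * (d / (2 * q))) = Real.pi * |h| * q ^ 2 / d ^ 2 := by
      field_simp; norm_num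
    rw [e]
    calc _ ≤ (M:ℝ) * (4 * |h| * q ^ 2 / d ^ 2) := by gcongr
      _ = (|h| * (4 * M) * q) * q / d ^ 2 := by ring
      _ ≤ 1 * q / d ^ 2 := by gcongr
      _ ≤ q / d := by
          rw [one_mul]
          apply div_le_div_of_nonneg_left hq0.le hd0
          nlinarith
  have e3 : 1 / (4 * (d / (2 * q))) + 1 / (4 * (d / (2 * q))) = (q:ℝ) / d := by
    field_simp; norm_num
  rw [e3]
  have : (q:ℝ) / d = q * d⁻¹ := by ring
  nlinarith

lemma phase_zero (h : ℝ) (M N K : ℕ) (hh0 : 0 < |h|)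
    (hh : |h| * (4 * M) ≤ 1) (hNM : N + K ≤ M) :
    ‖∑ n ∈ Finset.Ico N (N + K), ee (h * ((n + 1 : ℕ) : ℝ) ^ 2)‖ ≤ 1 / (|h| * (2 * N + 1)) := by
  rcases K with _ | k
  · simp only [add_zero, Finset.Ico_self, Finset.sum_empty, norm_zero]
    positivity
  have key := quad_phase h 0 N k (fun n => |h| * (2 * n + 1)) (by
    intro n hn
    rw [Finset.mem_Ico] at hn
    have hn' : (2 * (n:ℝ) + 1) ≤ 2 * M := by exact_mod_cast (by omega : 2 * n + 1 ≤ 2 * M)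
    rw [sub_zero, abs_mul, abs_of_pos (by positivity : (0:ℝ) < 2 * n + 1)]
    have := mul_le_mul_of_nonneg_left hn' (abs_nonneg h)
    refine ⟨by positivity, le_refl _, by nlinarith⟩)
  simp only [zero_mul, sub_zero] at key
  rw [← add_assoc]
  refine key.trans ?_
  have hpi := Real.pi_lt_four
  have hpi0 := Real.pi_pos
  have hsum : ∀ k : ℕ, ∑ n ∈ Finset.Ico N (N + k), Real.pi * |h| / (4 * (|h| * (2 * (n:ℝ) + 1)) * (|h| * (2 * ((n+1 : ℕ) : ℝ) + 1)))
      = Real.pi / (8 * |h|) * (1 / (2 * N + 1) - 1 / (2 * ((N + k : ℕ) : ℝ) + 1)) := by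
    intro k
    induction k with
    | zero => simp
    | succ k ih =>
      rw [← add_assoc, Finset.sum_Ico_succ_top (by omega), ih]
      have : (0:ℝ) < 2 * ((N + k : ℕ) : ℝ) + 1 := by positivity
      have : (0:ℝ) < 2 * ((N + k + 1 : ℕ) : ℝ) + 1 := by positivity
      have e : ((N + k + 1 : ℕ) : ℝ) = ((N + k : ℕ) : ℝ) + 1 := by push_cast; ring
      rw [e] at this ⊢
      field_simp
      ring
  rw [hsum]
  have h1 : (0:ℝ) < 2 * N + 1 := by positivity
  have h2 : 1 / (4 * (|h| * (2 * ((N + k : ℕ):ℝ) + 1))) ≤ 1 / (4 * (|h| * (2 * (N:ℝ) + 1))) := by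
    apply one_div_le_one_div_of_le (by positivity)
    have : (N:ℝ) ≤ ((N + k : ℕ):ℝ) := by exact_mod_cast (by omega)
    gcongr
  have h3 : Real.pi / (8 * |h|) * (1 / (2 * N + 1) - 1 / (2 * ((N + k : ℕ) : ℝ) + 1)) ≤
      4 / (8 * |h|) * (1 / (2 * N + 1)) := by
    have : 0 ≤ 1 / (2 * ((N + k : ℕ) : ℝ) + 1) := by positivity
    have i1 : (1:ℝ) / (2 * N + 1) - 1 / (2 * ((N + k : ℕ) : ℝ) + 1) ≤ 1 / (2 * N + 1) := by linarith
    calc _ ≤ Real.pi / (8 * |h|) * (1 / (2 * N + 1)) := by gcongr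
      _ ≤ _ := by gcongr
  have e : 1 / (4 * (|h| * (2 * (N:ℝ) + 1))) + 1 / (4 * (|h| * (2 * (N:ℝ) + 1))) + 4 / (8 * |h|) * (1 / (2 * N + 1)) = 1 / (|h| * (2 * N + 1)) := by
    field_simp; norm_num
  linarith

lemma weight_anti (s : ℝ) (hs : 0 < s) (n : ℕ) :
    (((n + 1) + 1 : ℕ) : ℝ) ^ (-s) ≤ ((n + 1 : ℕ) : ℝ) ^ (-s) := by
  apply Real.rpow_le_rpow_of_nonpos (by positivity) _ (by linarith)
  push_cast; linarith

lemma tail_zero (s : ℝ) (hs : 0 < s) (h L : ℝ) (M N : ℕ) (hL : 1 ≤ L) (hhL : 1 / (2 * L ^ 2) ≤ |h|)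
    (hh : |h| * (4 * M) ≤ 1) (hNM : N ≤ M) (hN : L ≤ N + 1) :
    ‖∑ n ∈ Finset.Ico N M, ((((n + 1 : ℕ) : ℝ) ^ (-s) : ℝ) : ℂ) * ee (h * ((n + 1 : ℕ) : ℝ) ^ 2)‖ ≤
      2 * L ^ (1 - s) := by
  obtain ⟨K, rfl⟩ := Nat.exists_eq_add_of_le hNM
  have hL0 : 0 < L := by linarith
  have hh0 : 0 < |h| := lt_of_lt_of_le (by positivity) hhL
  have := abel_ineq (fun n => ee (h * ((n + 1 : ℕ) : ℝ) ^ 2)) (fun n => ((n + 1 : ℕ) : ℝ) ^ (-s)) N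
    (1 / (|h| * (2 * N + 1))) K (fun n _ => weight_anti s hs n) (fun n _ => by positivity)
    (fun k hk => phase_zero h (N + K) N k hh0 hh (by omega))
  refine this.trans ?_
  have h1 : ((N + 1 : ℕ) : ℝ) ^ (-s) ≤ L ^ (-s) :=
    Real.rpow_le_rpow_of_nonpos hL0 (by push_cast; linarith) (by linarith)
  have h2 : 1 / (|h| * (2 * N + 1)) ≤ 2 * L := by
    rw [div_le_iff₀ (by positivity)]
    rw [div_le_iff₀ (by positivity)] at hhL
    have : L ≤ 2 * N + 1 := by linarith [(Nat.cast_nonneg N : (0:ℝ) ≤ N)]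
    have := mul_le_mul_of_nonneg_left this (mul_nonneg hh0.le hL0.le)
    nlinarith
  calc _ ≤ L ^ (-s) * (2 * L) := by
        have : 0 ≤ 1 / (|h| * (2 * (N:ℝ) + 1)) := by positivity
        gcongr
    _ = 2 * L ^ (1 - s) := by
        rw [sub_eq_add_neg, Real.rpow_add hL0, Real.rpow_one]; ring

lemma norm_head (s : ℝ) (h : ℝ) (S : Finset ℕ) :
    ‖∑ n ∈ S, ((((n + 1 : ℕ) : ℝ) ^ (-s) : ℝ) : ℂ) * ee (h * ((n + 1 : ℕ) : ℝ) ^ 2)‖ ≤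
      ∑ n ∈ S, ((n + 1 : ℕ) : ℝ) ^ (-s) := by
  refine norm_sum_le_of_le _ fun n _ => ?_
  rw [norm_mul, ee_norm, mul_one, Complex.norm_real, Real.norm_of_nonneg (by positivity)]

lemma full_zero (s : ℝ) (hs : 0 < s) (h L D : ℝ) (M N : ℕ) (hL : 1 ≤ L)
    (hhL : 1 / (2 * L ^ 2) ≤ |h|)
    (hh : |h| * (4 * M) ≤ 1) (hNM : N ≤ M) (hD : 0 ≤ D)
    (hDs : N ≤ ⌊L⌋₊ → ∑ n ∈ Finset.Ico N ⌊L⌋₊, ((n + 1 : ℕ) : ℝ) ^ (-s) ≤ D) :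
    ‖∑ n ∈ Finset.Ico N M, ((((n + 1 : ℕ) : ℝ) ^ (-s) : ℝ) : ℂ) * ee (h * ((n + 1 : ℕ) : ℝ) ^ 2)‖ ≤
      D + 2 * L ^ (1 - s) := by
  have hpos : 0 ≤ 2 * L ^ (1 - s) := by positivity
  have hfl : L ≤ ⌊L⌋₊ + 1 := (Nat.lt_floor_add_one L).le
  rcases le_total ⌊L⌋₊ N with hK | hK
  · have : (⌊L⌋₊ : ℝ) ≤ N := by exact_mod_cast hK
    have := tail_zero s hs h L M N hL hhL hh hNM (by linarith)
    linarith
  · have hd := hDs hK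
    rcases le_total M ⌊L⌋₊ with hM | hM
    · have h1 := norm_head s h (Finset.Ico N M)
      have h2 : ∑ n ∈ Finset.Ico N M, ((n + 1 : ℕ) : ℝ) ^ (-s) ≤ ∑ n ∈ Finset.Ico N ⌊L⌋₊, ((n + 1 : ℕ) : ℝ) ^ (-s) := by
        apply Finset.sum_le_sum_of_subset_of_nonneg (Finset.Ico_subset_Ico_right hM)
        intros; positivity
      linarith
    · rw [← Finset.sum_Ico_consecutive _ hK hM]
      have h1 := norm_head s h (Finset.Ico N ⌊L⌋₊)
      have h2 := tail_zero s hs h L M ⌊L⌋₊ hL hhL hh hM hfl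
      refine (norm_add_le _ _).trans ?_
      linarith

lemma stdAddChar_ee (q : ℕ) [NeZero q] (k : ℤ) :
    ZMod.stdAddChar ((k : ℤ) : ZMod q) = ee ((k : ℝ) / q) := by
  rw [ZMod.stdAddChar_coe, ee]; congr 1; push_cast; ring

lemma main_split (s : ℝ) (hs : s ∈ Set.Ioc (1/2 : ℝ) 1) (q : ℕ) [NeZero q] (p : ℤ)
    (hp : IsUnit (p : ZMod q)) (h : ℝ) (M N : ℕ) (hN : (q : ℝ) / 4 ≤ N) (hNM : N ≤ M)
    (hh : |h| * (4 * M) * q ≤ 1) :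
    ‖∑ n ∈ Finset.Ico N M, ((((n + 1 : ℕ) : ℝ) ^ (-s) : ℝ) : ℂ) *
        ee (((n + 1 : ℕ) : ℝ) ^ 2 * (p / q + h))‖ ≤
      ‖TT q p 0‖ / q * ‖∑ n ∈ Finset.Ico N M, ((((n + 1 : ℕ) : ℝ) ^ (-s) : ℝ) : ℂ) *
        ee (h * ((n + 1 : ℕ) : ℝ) ^ 2)‖ +
      32 * ((1 + Real.log q) * (q : ℝ) ^ ((1:ℝ)/2 - s)) := by
  have hq1 : 1 ≤ q := NeZero.one_le
  have hq0 : (0:ℝ) < q := by exact_mod_cast hq1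
  have hqc : (q:ℂ) ≠ 0 := by exact_mod_cast hq0.ne'
  have hs0 : 0 < s := by linarith [hs.1]
  set W : ZMod q → ℂ := fun m => ∑ n ∈ Finset.Ico N M, ((((n + 1 : ℕ) : ℝ) ^ (-s) : ℝ) : ℂ) *
        ee (h * ((n + 1 : ℕ) : ℝ) ^ 2 - ((m.val : ℝ) / q) * ((n + 1 : ℕ) : ℝ)) with hW
  have hW0 : W 0 = ∑ n ∈ Finset.Ico N M, ((((n + 1 : ℕ) : ℝ) ^ (-s) : ℝ) : ℂ) *
        ee (h * ((n + 1 : ℕ) : ℝ) ^ 2) := by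
    simp [hW]
  rw [← hW0]
  have hexp : ∀ n : ℕ, ee (((n + 1 : ℕ) : ℝ) ^ 2 * (p / q + h)) =
      (1 / (q:ℂ)) * ∑ m : ZMod q, TT q p m *
        ee (h * ((n + 1 : ℕ) : ℝ) ^ 2 - ((m.val : ℝ) / q) * ((n + 1 : ℕ) : ℝ)) := by
    intro n
    have h1 := TT_inv q (p : ZMod q) ((n + 1 : ℕ) : ZMod q)
    have h2 : ZMod.stdAddChar ((p : ZMod q) * ((n + 1 : ℕ) : ZMod q) ^ 2) =
        ee ((p : ℝ) / q * ((n + 1 : ℕ) : ℝ) ^ 2) := by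
      have := stdAddChar_ee q (p * ((n + 1 : ℕ) : ℤ) ^ 2)
      rw [show (p : ZMod q) * ((n + 1 : ℕ) : ZMod q) ^ 2 = ((p * ((n + 1 : ℕ) : ℤ) ^ 2 : ℤ) : ZMod q) by
        push_cast; ring, this]
      congr 1; push_cast; ring
    have h3 : ∀ m : ZMod q, ZMod.stdAddChar (-(m * ((n + 1 : ℕ) : ZMod q))) =
        ee (- (((m.val : ℝ) / q) * ((n + 1 : ℕ) : ℝ))) := by
      intro m
      have := stdAddChar_ee q (- ((m.val : ℤ) * ((n + 1 : ℕ) : ℤ)))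
      rw [show (-(m * ((n + 1 : ℕ) : ZMod q))) = ((- ((m.val : ℤ) * ((n + 1 : ℕ) : ℤ)) : ℤ) : ZMod q) by
        push_cast; rw [ZMod.natCast_zmod_val], this]
      congr 1; push_cast; ring
    have h4 : ee (((n + 1 : ℕ) : ℝ) ^ 2 * (p / q + h)) =
        ee ((p : ℝ) / q * ((n + 1 : ℕ) : ℝ) ^ 2) * ee (h * ((n + 1 : ℕ) : ℝ) ^ 2) := by
      rw [← ee_add]; congr 1; ring
    have h5 : ∀ m : ZMod q, ee (h * ((n + 1 : ℕ) : ℝ) ^ 2 - ((m.val : ℝ) / q) * ((n + 1 : ℕ) : ℝ)) =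
        ZMod.stdAddChar (-(m * ((n + 1 : ℕ) : ZMod q))) * ee (h * ((n + 1 : ℕ) : ℝ) ^ 2) := by
      intro m
      rw [h3, ← ee_add]; congr 1; ring
    simp_rw [h5, ← mul_assoc]
    rw [← Finset.sum_mul, h1, h2, h4]
    field_simp
  have hdecomp : ∑ n ∈ Finset.Ico N M, ((((n + 1 : ℕ) : ℝ) ^ (-s) : ℝ) : ℂ) *
        ee (((n + 1 : ℕ) : ℝ) ^ 2 * (p / q + h)) = (1 / (q:ℂ)) * ∑ m : ZMod q, TT q p m * W m := by
    simp_rw [hexp, hW, Finset.mul_sum]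
    rw [Finset.sum_comm]
    refine Finset.sum_congr rfl fun m _ => Finset.sum_congr rfl fun n _ => ?_
    ring
  rw [hdecomp, ← Finset.add_sum_erase _ _ (Finset.mem_univ (0 : ZMod q)), mul_add]
  have hWm : ∀ m ∈ Finset.univ.erase (0 : ZMod q), ‖W m‖ ≤
      4 * (q:ℝ) ^ (-s) * (2 * q * ((m.val : ℝ)⁻¹ + ((q : ℝ) - m.val)⁻¹)) := by
    intro m hm
    have hm0 : m ≠ 0 := (Finset.mem_erase.1 hm).1
    have hv : 1 ≤ m.val := by
      rcases Nat.eq_zero_or_pos m.val with h | h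
      · exact absurd ((ZMod.val_eq_zero m).1 h) hm0
      · exact h
    have hv2 := ZMod.val_lt m
    obtain ⟨K, rfl⟩ := Nat.exists_eq_add_of_le hNM
    have := abel_ineq (fun n => ee (h * ((n + 1 : ℕ) : ℝ) ^ 2 - ((m.val : ℝ) / q) * ((n + 1 : ℕ) : ℝ)))
      (fun n => ((n + 1 : ℕ) : ℝ) ^ (-s)) N _ K (fun n _ => weight_anti s hs0 n)
      (fun n _ => by positivity)
      (fun k hk => phase_nonzero h q m.val (N + K) N k hv hv2 hh (by omega))
    refine this.trans ?_
    have h6 : (0:ℝ) < (q:ℝ) - m.val := by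
      have : (m.val : ℝ) < q := by exact_mod_cast hv2
      linarith
    have h7 : ((N + 1 : ℕ) : ℝ) ^ (-s) ≤ 4 * (q:ℝ) ^ (-s) := by
      calc _ ≤ ((q:ℝ) / 4) ^ (-s) :=
            Real.rpow_le_rpow_of_nonpos (by positivity) (by push_cast; linarith) (by linarith)
        _ = (4:ℝ) ^ s * (q:ℝ) ^ (-s) := by
            rw [Real.div_rpow hq0.le (by norm_num), Real.rpow_neg (by norm_num : (0:ℝ) ≤ 4), div_inv_eq_mul,
              mul_comm]
        _ ≤ _ := by
            gcongr
            calc (4:ℝ) ^ s ≤ 4 ^ (1:ℝ) := Real.rpow_le_rpow_of_exponent_le (by norm_num) hs.2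
              _ = 4 := Real.rpow_one _
    exact mul_le_mul_of_nonneg_right h7 (by positivity)
  refine (norm_add_le _ _).trans ?_
  have hmain : ‖1 / (q:ℂ) * (TT q p 0 * W 0)‖ = ‖TT q p 0‖ / q * ‖W 0‖ := by
    rw [norm_mul, norm_mul, norm_div, norm_one, Complex.norm_natCast]; ring
  rw [hmain]
  gcongr
  rw [norm_mul, norm_div, norm_one, Complex.norm_natCast]
  have hsum : ‖∑ m ∈ Finset.univ.erase (0 : ZMod q), TT q p m * W m‖ ≤
      Real.sqrt (2 * q) * (8 * q * (q:ℝ) ^ (-s) * (2 * (1 + Real.log q))) := by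
    calc _ ≤ ∑ m ∈ Finset.univ.erase (0 : ZMod q), Real.sqrt (2 * q) *
          (4 * (q:ℝ) ^ (-s) * (2 * q * ((m.val : ℝ)⁻¹ + ((q : ℝ) - m.val)⁻¹))) := by
          refine norm_sum_le_of_le _ fun m hm => ?_
          rw [norm_mul]
          exact mul_le_mul (TT_norm q p m hp) (hWm m hm) (norm_nonneg _) (Real.sqrt_nonneg _)
      _ ≤ ∑ m : ZMod q, Real.sqrt (2 * q) *
          (4 * (q:ℝ) ^ (-s) * (2 * q * ((m.val : ℝ)⁻¹ + ((q : ℝ) - m.val)⁻¹))) := by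
          apply Finset.sum_le_sum_of_subset_of_nonneg (Finset.erase_subset _ _)
          intro m _ _
          have : (m.val : ℝ) < q := by exact_mod_cast ZMod.val_lt m
          have : (0:ℝ) < (q:ℝ) - m.val := by linarith
          positivity
      _ = Real.sqrt (2 * q) * (8 * q * (q:ℝ) ^ (-s) *
            ∑ m : ZMod q, ((m.val : ℝ)⁻¹ + ((q : ℝ) - m.val)⁻¹)) := by
          rw [Finset.mul_sum, Finset.mul_sum]
          refine Finset.sum_congr rfl fun m _ => ?_
          ring
      _ ≤ _ := by
          rw [sum_zmod_val q (fun i => ((i : ℝ)⁻¹ + ((q : ℝ) - i)⁻¹))]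
          have := sum_recip q hq1
          gcongr
  have hlog : 0 ≤ Real.log q := Real.log_natCast_nonneg q
  have hsq : Real.sqrt (2 * q) ≤ 2 * Real.sqrt q := by
    rw [show 2 * Real.sqrt q = Real.sqrt (4 * q) by
      rw [Real.sqrt_mul (by norm_num), show (4:ℝ) = 2 ^ 2 by norm_num, Real.sqrt_sq (by norm_num)]]
    apply Real.sqrt_le_sqrt; linarith
  calc _ ≤ 1 / (q:ℝ) * ((2 * Real.sqrt q) * (8 * q * (q:ℝ) ^ (-s) * (2 * (1 + Real.log q)))) := by
        gcongr
        exact hsum.trans (by gcongr)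
    _ = 32 * ((1 + Real.log q) * (Real.sqrt q * (q : ℝ) ^ (-s))) := by
        field_simp; norm_num
    _ = _ := by
        rw [Real.sqrt_eq_rpow, ← Real.rpow_add hq0, sub_eq_add_neg]

lemma cfX_prop (x : ℝ) (hx : x ∈ Set.Ioo (0:ℝ) 1) (hi : Irrational x) (j : ℕ) :
    Irrational (cfX x j) ∧ 0 < cfX x j ∧ cfX x j < 1 := by
  induction j with
  | zero => exact ⟨hi, hx.1, hx.2⟩
  | succ j ih =>
    have h1 : Irrational (cfX x (j+1)) := by
      have : cfX x (j+1) = (cfX x j)⁻¹ - (⌊(cfX x j)⁻¹⌋ : ℤ) := rfl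
      rw [this]
      exact (ih.1.inv).sub_intCast _
    refine ⟨h1, lt_of_le_of_ne (Int.fract_nonneg _) (fun h => ?_), Int.fract_lt_one _⟩
    exact h1.ne_zero h.symm

lemma cfA_pos (x : ℝ) (hx : x ∈ Set.Ioo (0:ℝ) 1) (hi : Irrational x) (j : ℕ) : 1 ≤ cfA x j := by
  obtain ⟨_, h1, h2⟩ := cfX_prop x hx hi j
  unfold cfA
  rw [Int.le_floor]
  push_cast
  exact (one_le_inv₀ h1).2 h2.le

lemma cfX_inv (x : ℝ) (j : ℕ) : (cfX x j)⁻¹ = cfA x j + cfX x (j+1) := by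
  have : cfX x (j+1) = Int.fract (cfX x j)⁻¹ := rfl
  rw [this, cfA, Int.floor_add_fract]

lemma cfQ_mono (x : ℝ) (hx : x ∈ Set.Ioo (0:ℝ) 1) (hi : Irrational x) (j : ℕ) :
    1 ≤ cfQ x j ∧ cfQ x j ≤ cfQ x (j+1) := by
  induction j with
  | zero => exact ⟨le_refl _, cfA_pos x hx hi 0⟩
  | succ j ih =>
    have h : cfQ x (j+2) = cfA x (j + 1) * cfQ x (j + 1) + cfQ x j := by rw [cfQ]
    have := cfA_pos x hx hi (j+1)
    refine ⟨by linarith, ?_⟩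
    rw [h]
    nlinarith

lemma cf_det (x : ℝ) (j : ℕ) :
    cfP x (j+1) * cfQ x j - cfP x j * cfQ x (j+1) = (-1) ^ j := by
  induction j with
  | zero => simp [cfP, cfQ]
  | succ j ih =>
    have h : cfQ x (j+2) = cfA x (j + 1) * cfQ x (j + 1) + cfQ x j := by rw [cfQ]
    have h' : cfP x (j+2) = cfA x (j + 1) * cfP x (j + 1) + cfP x j := by rw [cfP]
    rw [h, h', pow_succ, ← ih]; ring

lemma cf_eq (x : ℝ) (hx : x ∈ Set.Ioo (0:ℝ) 1) (hi : Irrational x) (j : ℕ) :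
    x * (cfQ x (j+1) + cfX x (j+1) * cfQ x j) = cfP x (j+1) + cfX x (j+1) * cfP x j := by
  induction j with
  | zero =>
    have h1 := cfX_inv x 0
    have h2 : cfX x 0 = x := rfl
    rw [h2] at h1
    have : x * x⁻¹ = 1 := mul_inv_cancel₀ hx.1.ne'
    simp [cfP, cfQ, ← h1, this]
  | succ j ih =>
    have h : cfQ x (j+2) = cfA x (j + 1) * cfQ x (j + 1) + cfQ x j := by rw [cfQ]
    have h' : cfP x (j+2) = cfA x (j + 1) * cfP x (j + 1) + cfP x j := by rw [cfP]
    have h1 := cfX_inv x (j+1)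
    have h0 := (cfX_prop x hx hi (j+1)).2.1
    rw [h, h']
    push_cast
    have e : cfX x (j+1+1) = (cfX x (j+1))⁻¹ - cfA x (j+1) := by linarith
    rw [e]
    field_simp
    linear_combination ih

lemma cf_approx (x : ℝ) (hx : x ∈ Set.Ioo (0:ℝ) 1) (hi : Irrational x) (j : ℕ) :
    1 / (2 * ((cfQ x j : ℝ) * cfQ x (j+1))) ≤ |x - (cfP x j : ℝ) / cfQ x j| ∧
    |x - (cfP x j : ℝ) / cfQ x j| ≤ 1 / ((cfQ x j : ℝ) * cfQ x (j+1)) := by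
  obtain ⟨q1, q2⟩ := cfQ_mono x hx hi j
  obtain ⟨_, y0, y1⟩ := cfX_prop x hx hi (j+1)
  have hq : (1:ℝ) ≤ cfQ x j := by exact_mod_cast q1
  have hq' : (cfQ x j : ℝ) ≤ cfQ x (j+1) := by exact_mod_cast q2
  have hdet : (cfP x (j+1) : ℝ) * cfQ x j - cfP x j * cfQ x (j+1) = (-1) ^ j := by
    exact_mod_cast cf_det x j
  have heq := cf_eq x hx hi j
  set y := cfX x (j+1)
  set q : ℝ := ((cfQ x j : ℤ) : ℝ)
  set q' : ℝ := ((cfQ x (j+1) : ℤ) : ℝ)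
  have hy : 0 < y * q := by positivity
  have hd : x - (cfP x j : ℝ) / q = (-1) ^ j / (q * (q' + y * q)) := by
    have : q' + y * q ≠ 0 := by linarith
    have : q ≠ 0 := by linarith
    rw [eq_div_iff (by positivity), ← hdet]
    field_simp
    linear_combination q * heq
  have h3 : q * q' ≤ q * (q' + y * q) := by nlinarith
  have h4 : q * (q' + y * q) ≤ 2 * (q * q') := by
    have : y * q ≤ q' := by nlinarith
    nlinarith
  have h5 : 0 < q * q' := by nlinarith
  rw [hd, abs_div, abs_pow, abs_neg, abs_one, one_pow, abs_of_pos (by linarith)]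
  exact ⟨one_div_le_one_div_of_le (by linarith) h4, one_div_le_one_div_of_le h5 h3⟩

lemma cf_coprime (x : ℝ) (j : ℕ) : IsCoprime (cfP x j) (cfQ x j) := by
  have := cf_det x j
  refine ⟨-(-1)^j * cfQ x (j+1), (-1)^j * cfP x (j+1), ?_⟩
  have h : ((-1:ℤ))^j * (-1)^j = 1 := by rw [← mul_pow]; simp
  linear_combination (-1)^j * this + h

lemma FsN_diff (s x : ℝ) (N M : ℕ) (hNM : N ≤ M) :
    FsN s M x - FsN s N x = ∑ n ∈ Finset.Ico N M, ((((n + 1 : ℕ) : ℝ) ^ (-s) : ℝ) : ℂ) *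
        ee (((n + 1 : ℕ) : ℝ) ^ 2 * x) := by
  have hF : ∀ K, FsN s K x = ∑ n ∈ Finset.range K, ((((n + 1 : ℕ) : ℝ) ^ (-s) : ℝ) : ℂ) *
        ee (((n + 1 : ℕ) : ℝ) ^ 2 * x) := by
    intro K
    unfold FsN
    rw [Finset.range_eq_Ico, Finset.sum_Ico_add' (fun n : ℕ => ((((n : ℕ) : ℝ) ^ (-s) : ℝ) : ℂ) *
        ee (((n : ℕ) : ℝ) ^ 2 * x)) 0 K 1]
    apply Finset.sum_congr
    · ext n; simp only [Finset.mem_Icc, Finset.mem_Ico]; omega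
    · intro n _
      unfold ee
      congr 2
      push_cast; ring
  rw [hF, hF, Finset.sum_Ico_eq_sub _ hNM]

lemma gaussTau_TT (q : ℕ) [NeZero q] (p : ℤ) : gaussTau p q 0 = TT q p 0 := by
  unfold gaussTau TT
  rw [← sum_zmod_val q]
  refine Finset.sum_congr rfl fun b _ => ?_
  have := stdAddChar_ee q (p * (b.val : ℤ) ^ 2)
  rw [show (p : ZMod q) * b ^ 2 + 0 * b = ((p * (b.val : ℤ) ^ 2 : ℤ) : ZMod q) by
    push_cast; rw [ZMod.natCast_zmod_val]; ring, this]
  unfold ee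
  congr 1
  push_cast; ring

lemma sqrt_identity (s q q' : ℝ) (hq : 0 < q) (hq' : 0 < q') :
    Real.sqrt (q' / (q * q') ^ s) = (Real.sqrt (q * q')) ^ (1 - s) / Real.sqrt q := by
  have h : 0 < q * q' := by positivity
  rw [Real.sqrt_eq_iff_eq_sq (by positivity) (by positivity), div_pow, Real.sq_sqrt hq.le,
    ← Real.rpow_natCast, ← Real.rpow_mul (Real.sqrt_nonneg _), mul_comm (1 - s),
    Real.rpow_mul (Real.sqrt_nonneg _), Real.rpow_natCast, Real.sq_sqrt h.le,
    Real.rpow_sub h, Real.rpow_one]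
  field_simp

/-- For `s ∈ (1/2,1]` there is a constant `C > 0`, depending only on
`s`, such that for every irrational `x ∈ (0,1)` with convergents `(p_j/q_j)_{j≥1}`, every
index `j ≥ 1`, and all integers `N, M` with `q_j/4 ≤ N < M ≤ q_{j+1}/4`:
`|F_{s,M}(x) - F_{s,N}(x)| ≤ C (|θ_0(p_j/q_j)| δ_j √(q_{j+1}/(q_j q_{j+1})^s)
  + (1 + log q_j) q_j^{1/2-s})`. -/
theorem increment_bound_between_denominators (s : ℝ) (hs : s ∈ Set.Ioc (1/2 : ℝ) 1) :
    ∃ C : ℝ, 0 < C ∧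
      ∀ x : ℝ, x ∈ Set.Ioo (0 : ℝ) 1 → Irrational x →
        ∀ j : ℕ, 1 ≤ j →
          ∀ N M : ℕ, (cfQ x j : ℝ) / 4 ≤ (N : ℝ) → N < M → (M : ℝ) ≤ (cfQ x (j + 1) : ℝ) / 4 →
            ‖FsN s M x - FsN s N x‖ ≤
              C * (‖gaussTheta (cfP x j) (cfQ x j).toNat 0‖ * sigTerm s x j +
                (1 + Real.log (cfQ x j : ℝ)) * (cfQ x j : ℝ) ^ ((1 : ℝ) / 2 - s)) := by
  obtain ⟨hs1, hs2⟩ := hs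
  have hs0 : 0 < s := by linarith
  have hinv : 0 ≤ 1 / (1 - s) := div_nonneg zero_le_one (by linarith)
  refine ⟨1 / (1 - s) + 50, by linarith, ?_⟩
  intro x hx hi j hj N M hN hNM hM
  obtain ⟨hq1, hqq⟩ := cfQ_mono x hx hi j
  obtain ⟨ha1, ha2⟩ := cf_approx x hx hi j
  have hcop := cf_coprime x j
  obtain ⟨q, hq⟩ := Int.eq_ofNat_of_zero_le (by linarith : 0 ≤ cfQ x j)
  have hsig : sigTerm s x j = deltaJ s x j *
    Real.sqrt ((cfQ x (j + 1) : ℝ) / ((cfQ x j : ℝ) * (cfQ x (j + 1) : ℝ)) ^ s) := rfl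
  have hdel : deltaJ s x j =
    if s < 1 then 1 else Real.log ((cfQ x (j + 1) : ℝ) / (cfQ x j : ℝ)) := rfl
  have hq'r : (cfQ x j : ℝ) ≤ (cfQ x (j+1) : ℝ) := by exact_mod_cast hqq
  generalize hq' : (cfQ x (j + 1) : ℝ) = q' at *
  generalize cfP x j = p at *
  generalize sigTerm s x j = σ at *
  generalize deltaJ s x j = δ at *
  rw [hq] at hq1 hN ha1 ha2 hcop hsig hdel hq'r ⊢
  clear hq hq' hqq
  simp only [Int.cast_natCast, Int.toNat_natCast] at *
  have hqpos : 1 ≤ q := by exact_mod_cast hq1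
  have : NeZero q := ⟨by omega⟩
  have hq0 : (1:ℝ) ≤ q := by exact_mod_cast hqpos
  have hqp : (0:ℝ) < q := by linarith
  have hq'0 : 0 < q' := by linarith
  have hunit : IsUnit (p : ZMod q) := by
    obtain ⟨a, b, hab⟩ := hcop
    have : ((a * p + b * q : ℤ) : ZMod q) = 1 := by rw [hab]; simp
    push_cast at this
    rw [ZMod.natCast_self, mul_zero, add_zero] at this
    exact IsUnit.of_mul_eq_one (a : ZMod q) (by rw [mul_comm]; exact this)
  set h : ℝ := x - (p : ℝ) / q with hh
  have hx' : x = p / q + h := by rw [hh]; ring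
  have hhM : |h| * (4 * M) * q ≤ 1 := by
    rw [le_div_iff₀ (by positivity)] at ha2
    have h4 : 4 * (M:ℝ) ≤ q' := by linarith
    have := mul_le_mul_of_nonneg_left h4 (mul_nonneg (abs_nonneg h) hqp.le)
    nlinarith
  have hhM' : |h| * (4 * M) ≤ 1 := by
    have : 0 ≤ |h| * (4 * M) := by positivity
    nlinarith
  have hNr : 1 ≤ N := by
    have : (0:ℝ) < N := by linarith
    exact_mod_cast this
  have hNr' : (0:ℝ) < N := by exact_mod_cast hNr
  rw [FsN_diff s x N M hNM.le]
  have hsplit := main_split s ⟨hs1, hs2⟩ q p hunit h M N hN hNM.le hhM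
  rw [← hx'] at hsplit
  refine hsplit.trans ?_
  set L := Real.sqrt (q * q') with hL
  have hLsq : L ^ 2 = q * q' := Real.sq_sqrt (by positivity)
  have hLq : (q:ℝ) ≤ L := Real.le_sqrt_of_sq_le (by nlinarith)
  have hL1 : 1 ≤ L := by linarith
  have hL0 : 0 < L := by linarith
  have hhL : 1 / (2 * L ^ 2) ≤ |h| := by rw [hLsq]; exact ha1
  have hfloor : (⌊L⌋₊ : ℝ) ≤ L := Nat.floor_le hL0.le
  set E := (1 + Real.log q) * (q : ℝ) ^ ((1:ℝ)/2 - s) with hE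
  have hlog : 0 ≤ Real.log q := Real.log_natCast_nonneg q
  have hE0 : 0 ≤ E := by positivity
  have hsq0 : 0 < Real.sqrt q := Real.sqrt_pos.2 hqp
  have hsqq : Real.sqrt q * Real.sqrt q = q := Real.mul_self_sqrt hqp.le
  set g := ‖gaussTheta p q 0‖ with hg
  have hgT : ‖TT q p 0‖ / q = g / Real.sqrt q := by
    rw [hg, gaussTheta, gaussTau_TT, norm_div, Complex.norm_real,
      Real.norm_of_nonneg hsq0.le, div_div, hsqq]
  have hg0 : 0 ≤ g := norm_nonneg _
  rw [hgT]
  rw [sqrt_identity s q q' hqp hq'0, ← hL] at hsig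
  rcases lt_or_eq_of_le hs2 with hlt | heq
  · have h1s : 0 < 1 - s := by linarith
    have hfull := full_zero s hs0 h L (L ^ (1 - s) / (1 - s)) M N hL1 hhL hhM' hNM.le (by positivity) (by
      intro hK
      obtain ⟨K, hK⟩ := Nat.exists_eq_add_of_le hK
      have := sum_rpow_le s hs0 hlt N K
      rw [← hK] at this
      refine this.trans ?_
      gcongr)
    rw [if_pos hlt] at hdel
    rw [hdel, one_mul] at hsig
    have hσ0 : 0 ≤ σ := by rw [hsig]; positivity
    have hgσ : 0 ≤ g * σ := mul_nonneg hg0 hσ0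
    calc _ ≤ g / Real.sqrt q * (L ^ (1 - s) / (1 - s) + 2 * L ^ (1 - s)) + 32 * E := by gcongr
      _ = (1 / (1 - s) + 2) * (g * σ) + 32 * E := by rw [hsig]; ring
      _ ≤ _ := by
        have := mul_nonneg hinv hE0
        linarith
  · subst heq
    rw [if_neg (lt_irrefl _)] at hdel
    have hlog0 : 0 ≤ Real.log (q' / q) := Real.log_nonneg (by rw [le_div_iff₀ hqp]; linarith)
    have hlogL : Real.log (L / (q / 4)) = Real.log (q' / q) / 2 + Real.log 4 := by
      rw [hL, Real.log_div (by positivity) (by positivity), Real.log_sqrt (by positivity),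
        Real.log_mul (by positivity) (by positivity), Real.log_div (by positivity) (by positivity),
        Real.log_div (by positivity) (by positivity)]
      ring
    have hlog4 : Real.log 4 ≤ 3 := by
      have := Real.log_le_sub_one_of_pos (by norm_num : (0:ℝ) < 4)
      linarith
    have hlog40 : 0 ≤ Real.log 4 := Real.log_nonneg (by norm_num)
    have hfull := full_zero 1 hs0 h L (Real.log (L / (q / 4))) M N hL1 hhL hhM' hNM.le
      (by rw [hlogL]; linarith) (by
      intro hK
      obtain ⟨K, hK'⟩ := Nat.exists_eq_add_of_le hK
      have := sum_inv_le_log N K hNr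
      rw [← hK'] at this
      simp only [Real.rpow_neg_one]
      refine this.trans ?_
      have hKpos : (0:ℝ) < (⌊L⌋₊ : ℝ) := by exact_mod_cast (by omega : 0 < ⌊L⌋₊)
      apply Real.log_le_log (by positivity)
      gcongr)
    rw [hlogL] at hfull
    simp only [sub_self, Real.rpow_zero, mul_one] at hfull hsig
    have hE1 : 1 / Real.sqrt q ≤ E := by
      have : (q:ℝ) ^ ((1:ℝ)/2 - 1) = 1 / Real.sqrt q := by
        rw [Real.sqrt_eq_rpow, one_div ((q:ℝ) ^ _), ← Real.rpow_neg hqp.le]; norm_num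
      rw [hE, this]
      have : 0 ≤ 1 / Real.sqrt q := by positivity
      exact le_mul_of_one_le_left this (by linarith)
    have hg2 : g ≤ 2 := by
      have h1 := TT_norm q p 0 hunit
      have h2 : Real.sqrt (2 * q) ≤ 2 * Real.sqrt q := by
        rw [Real.sqrt_mul (by norm_num)]
        have : Real.sqrt 2 ≤ 2 := by rw [Real.sqrt_le_left (by norm_num)]; norm_num
        gcongr
      have h3 : ‖TT q p 0‖ = g * Real.sqrt q := by
        have h4 := (div_eq_div_iff hqp.ne' hsq0.ne').1 hgT
        apply mul_right_cancel₀ hsq0.ne'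
        rw [h4, mul_assoc, hsqq]
      rw [h3] at h1
      exact le_of_mul_le_mul_right (h1.trans h2) hsq0
    have hσ : σ = Real.log (q' / q) * (1 / Real.sqrt q) := by rw [hsig, hdel]
    have hgσ : 0 ≤ g * σ := by rw [hσ]; positivity
    have hgE : g * (1 / Real.sqrt q) ≤ 2 * E :=
      mul_le_mul hg2 hE1 (by positivity) (by norm_num)
    calc _ ≤ g / Real.sqrt q * (Real.log (q' / q) / 2 + Real.log 4 + 2) + 32 * E := by gcongr
      _ ≤ g / Real.sqrt q * (Real.log (q' / q) / 2 + 3 + 2) + 32 * E := by gcongr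
      _ = 1 / 2 * (g * σ) + 5 * (g * (1 / Real.sqrt q)) + 32 * E := by rw [hσ]; ring
      _ ≤ _ := by
        simp only [sub_self, div_zero, zero_add]
        linarith
end

section
/- Let 1/2 < s < 1. There exist constants K ≥ 1 and c > 0, depending only on s, such that for all coprime integers p, q with q ≥ 1 and q ≢ 2 (mod 4), all 0 < H ≤ q^{−2}/K and all integers N > H^{−2}: the function h ↦ F_{s,N}(p/q + 2h) − F_{s,N}(p/q + h) satisfies ‖F_{s,N}(p/q + 2·) − F_{s,N}(p/q + ·)‖_{L²(μ̃_H)} ≥ c H^{(s−1)/2}/√q. -/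
open MeasureTheory Filter Set
open scoped Real BigOperators ENNReal

/-- The probability measure `μ̃_H`: normalized Lebesgue measure `dh/(2H)` on the annulus
`C(H) = [-2H,-H] ∪ [H,2H]`. -/
noncomputable def annMeasure (H : ℝ) : Measure ℝ :=
  (ENNReal.ofReal (2 * H))⁻¹ •
    (volume.restrict (Set.Icc (-(2 * H)) (-H) ∪ Set.Icc H (2 * H)))



/-- Generalized quadratic Gauss sum. -/
noncomputable def qGauss (q : ℕ) [NeZero q] (p k : ℤ) : ℂ :=
  ∑ x : ZMod q, ZMod.stdAddChar ((p : ZMod q) * x ^ 2 + (k : ZMod q) * x)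

lemma two_mul_zmod_eq_zero {q : ℕ} [NeZero q] (d : ZMod q) (hd : 2 * d = 0) :
    q ∣ 2 * d.val := by
  rw [← ZMod.natCast_eq_zero_iff]
  push_cast
  rw [ZMod.natCast_zmod_val]
  exact hd

lemma isUnit_p {q : ℕ} (p : ℤ) (h : IsCoprime p (q : ℤ)) : IsUnit (p : ZMod q) := by
  obtain ⟨u, v, huv⟩ := h
  have := congrArg (fun z : ℤ => (z : ZMod q)) huv
  simp at this
  exact IsUnit.of_mul_eq_one_right _ this

lemma qGauss_sq (q : ℕ) [NeZero q] (p k : ℤ) (h : IsCoprime p (q : ℤ)) :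
    qGauss q p k * (starRingEnd ℂ) (qGauss q p k) =
      q * ∑ d ∈ Finset.univ.filter (fun d : ZMod q => 2 * d = 0),
        ZMod.stdAddChar ((p : ZMod q) * d ^ 2 + (k : ZMod q) * d) := by
  unfold qGauss
  rw [map_sum, Finset.sum_mul_sum, Finset.sum_comm]
  have h1 : ∀ y : ZMod q, ∑ x : ZMod q, (ZMod.stdAddChar ((p : ZMod q) * x ^ 2 + (k : ZMod q) * x) : ℂ) *
      (starRingEnd ℂ) (ZMod.stdAddChar ((p : ZMod q) * y ^ 2 + (k : ZMod q) * y)) =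
      ∑ d : ZMod q, ZMod.stdAddChar ((p : ZMod q) * d ^ 2 + (k : ZMod q) * d) *
        ZMod.stdAddChar (y * (2 * (p : ZMod q) * d)) := by
    intro y
    rw [← Equiv.sum_comp (Equiv.addRight y)]
    refine Finset.sum_congr rfl fun d _ => ?_
    rw [← AddChar.map_neg_eq_conj, ← AddChar.map_add_eq_mul, ← AddChar.map_add_eq_mul]
    congr 1
    simp only [Equiv.coe_addRight]
    ring
  simp_rw [h1]
  rw [Finset.sum_comm]
  simp_rw [← Finset.mul_sum]
  simp_rw [AddChar.sum_mulShift _ (ZMod.isPrimitive_stdAddChar q)]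
  rw [Finset.mul_sum, Finset.sum_filter]
  refine Finset.sum_congr rfl fun d _ => ?_
  have : (2 * (p : ZMod q) * d = 0) ↔ 2 * d = 0 := by
    rw [show 2 * (p : ZMod q) * d = p * (2 * d) by ring]
    exact (isUnit_p p h).mul_right_eq_zero
  simp only [this]
  split_ifs <;> simp [ZMod.card, mul_comm]

lemma qGauss_norm_sq (q : ℕ) [NeZero q] (p k : ℤ) :
    (((‖qGauss q p k‖ ^ 2 : ℝ)) : ℂ) = qGauss q p k * (starRingEnd ℂ) (qGauss q p k) := by
  rw [Complex.mul_conj, Complex.normSq_eq_norm_sq]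

lemma qGauss_le (q : ℕ) [NeZero q] (p k : ℤ) (h : IsCoprime p (q : ℤ)) :
    ‖qGauss q p k‖ ≤ Real.sqrt (2 * q) := by
  apply Real.le_sqrt_of_sq_le
  have h1 : ‖qGauss q p k‖ ^ 2 = ‖(((‖qGauss q p k‖ ^ 2 : ℝ)) : ℂ)‖ := by
    rw [Complex.norm_real]; simp
  rw [h1, qGauss_norm_sq, qGauss_sq q p k h, norm_mul, mul_comm (2 : ℝ)]
  simp only [Complex.norm_natCast]
  gcongr
  refine (norm_sum_le _ _).trans ?_
  simp only [AddChar.norm_apply, Finset.sum_const, nsmul_eq_mul, mul_one]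
  have h2 : (Finset.univ.filter (fun d : ZMod q => 2 * d = 0)) ⊆ {0, ((q / 2 : ℕ) : ZMod q)} := by
    intro d hd
    simp only [Finset.mem_filter, Finset.mem_univ, true_and] at hd
    obtain ⟨t, ht⟩ := two_mul_zmod_eq_zero d hd
    have hlt := ZMod.val_lt d
    have : t < 2 := by
      by_contra hc
      push Not at hc
      have : q * 2 ≤ q * t := Nat.mul_le_mul_left _ hc
      omega
    simp only [Finset.mem_insert, Finset.mem_singleton]
    interval_cases t
    · left
      have : d.val = 0 := by omega
      exact (ZMod.val_eq_zero d).1 this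
    · right
      have : q / 2 = d.val := by omega
      rw [this, ZMod.natCast_zmod_val]
  have h3 := (Finset.card_le_card h2).trans Finset.card_le_two
  exact_mod_cast h3

lemma qGauss_ge (q : ℕ) [NeZero q] (p : ℤ) (h : IsCoprime p (q : ℤ)) (hq : q % 4 ≠ 2) :
    Real.sqrt q ≤ ‖qGauss q p 0‖ := by
  apply Real.sqrt_le_iff.2 ⟨norm_nonneg _, ?_⟩
  have h1 : ‖qGauss q p 0‖ ^ 2 = ‖(((‖qGauss q p 0‖ ^ 2 : ℝ)) : ℂ)‖ := by
    rw [Complex.norm_real]; simp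
  rw [h1, qGauss_norm_sq, qGauss_sq q p 0 h]
  have h2 : ∀ d ∈ Finset.univ.filter (fun d : ZMod q => 2 * d = 0),
      (ZMod.stdAddChar ((p : ZMod q) * d ^ 2 + ((0 : ℤ) : ZMod q) * d) : ℂ) = 1 := by
    intro d hd
    simp only [Finset.mem_filter, Finset.mem_univ, true_and] at hd
    have hdvd := two_mul_zmod_eq_zero d hd
    have : d ^ 2 = 0 := by
      rw [← ZMod.natCast_zmod_val d]
      norm_cast
      rw [ZMod.natCast_eq_zero_iff]
      rcases Nat.even_or_odd q with he | ho
      · have h4 : q % 4 = 0 := by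
          obtain ⟨r, hr⟩ := he
          omega
        obtain ⟨m, hm⟩ := Nat.dvd_of_mod_eq_zero h4
        obtain ⟨t, ht⟩ := hdvd
        have : d.val = 2 * m * t := by
          have : 2 * d.val = 2 * (2 * m * t) := by rw [ht, hm]; ring
          omega
        rw [this, hm]
        exact ⟨m * t ^ 2, by ring⟩
      · have : q ∣ d.val :=
          Nat.Coprime.dvd_of_dvd_mul_left (Nat.coprime_two_right.2 ho) hdvd
        exact this.trans (dvd_pow_self _ two_ne_zero)
    rw [this]; simp
  rw [Finset.sum_congr rfl h2]
  simp only [Finset.sum_const, nsmul_eq_mul, mul_one, norm_mul, Complex.norm_natCast]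
  have h3 : 1 ≤ (Finset.univ.filter (fun d : ZMod q => 2 * d = 0)).card :=
    Finset.card_pos.2 ⟨0, by simp⟩
  have h4 : (1 : ℝ) ≤ ((Finset.univ.filter (fun d : ZMod q => 2 * d = 0)).card : ℝ) := by
    exact_mod_cast h3
  nlinarith [(Nat.cast_nonneg q : (0 : ℝ) ≤ q)]

/-- The Gauss sum over `Fin q`, in explicit exponential form. -/
lemma qGauss_fin (q : ℕ) [NeZero q] (p k : ℤ) :
    ∑ r : Fin q, Complex.exp (2 * Real.pi * Complex.I * ((r : ℕ) : ℂ) ^ 2 * ((p : ℂ) / q)) *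
      Complex.exp (2 * Real.pi * Complex.I * k * (((r : ℕ) : ℂ) / q)) = qGauss q p k := by
  have h1 : ∀ n : ℕ, Complex.exp (2 * Real.pi * Complex.I * (n : ℂ) ^ 2 * ((p : ℂ) / q)) *
      Complex.exp (2 * Real.pi * Complex.I * k * ((n : ℂ) / q)) =
      ZMod.stdAddChar ((p : ZMod q) * (n : ZMod q) ^ 2 + (k : ZMod q) * (n : ZMod q)) := by
    intro n
    have := ZMod.stdAddChar_coe (N := q) (p * (n : ℤ) ^ 2 + k * n)
    push_cast at this
    rw [this, ← Complex.exp_add]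
    congr 1
    ring
  simp_rw [h1]
  unfold qGauss
  obtain ⟨m, rfl⟩ : ∃ m, q = m + 1 := ⟨q - 1, by have := NeZero.pos q; omega⟩
  refine Finset.sum_congr rfl fun x _ => ?_
  have : ((x : ℕ) : ZMod (m + 1)) = x := by
    exact ZMod.natCast_zmod_val (n := m + 1) x
  rw [this]

open FourierTransform in
lemma fourier_decay (f f' f'' : ℝ → ℂ) (hf : ∀ x, HasDerivAt f (f' x) x)
    (hf' : ∀ x, HasDerivAt f' (f'' x) x) (i0 : Integrable f) (i1 : Integrable f')
    (i2 : Integrable f'') (k : ℝ) :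
    (4 * π ^ 2 * k ^ 2) * ‖𝓕 f k‖ ≤ ∫ x, ‖f'' x‖ := by
  have d0 : deriv f = f' := funext fun x => (hf x).deriv
  have d1 : deriv f' = f'' := funext fun x => (hf' x).deriv
  have e1 := Real.fourier_deriv i0 (fun x => (hf x).differentiableAt) (d0 ▸ i1)
  have e2 := Real.fourier_deriv i1 (fun x => (hf' x).differentiableAt) (d1 ▸ i2)
  rw [d0] at e1
  rw [d1, e1] at e2
  have e3 := congrFun e2 k
  have h : ‖𝓕 f'' k‖ ≤ ∫ x, ‖f'' x‖ :=
    VectorFourier.norm_fourierIntegral_le_integral_norm _ _ _ _ _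
  rw [e3] at h
  simp only [norm_smul, norm_mul, Complex.norm_real, Complex.norm_I, Real.norm_eq_abs,
    Complex.norm_ofNat, abs_of_pos Real.pi_pos, mul_one] at h
  calc (4 * π ^ 2 * k ^ 2) * ‖𝓕 f k‖ = 2 * π * |k| * (2 * π * |k| * ‖𝓕 f k‖) := by
        rw [← sq_abs k]; ring
    _ ≤ _ := h

/-- universal constant -/
noncomputable def C0 : ℝ := ∑' k : ℤ, 1 / (4 * π ^ 2 * (k : ℝ) ^ 2)

lemma summable_C0 : Summable (fun k : ℤ => 1 / (4 * π ^ 2 * (k : ℝ) ^ 2)) := by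
  have := (Real.summable_one_div_int_pow (p := 2)).2 (by norm_num)
  refine (this.mul_left (1 / (4 * π ^ 2))).congr fun k => ?_
  rw [one_div_mul_one_div]

lemma summable_af (f : ℝ → ℂ) (C : ℝ) (hC : ∀ x, x ^ 2 * ‖f x‖ ≤ C) (δ : ℝ) (hδ : 0 < δ)
    (a : ℤ → ℂ) (ha : ∀ n, ‖a n‖ ≤ 1) : Summable (fun n : ℤ => a n * f (δ * n)) := by
  have := ((Real.summable_one_div_int_pow (p := 2)).2 (by norm_num)).mul_left (C / δ ^ 2)
  refine Summable.of_norm_bounded_eventually this ?_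
  have h0 : ∀ᶠ n : ℤ in cofinite, n ≠ 0 := by
    simpa using (Set.finite_singleton (0 : ℤ)).compl_mem_cofinite
  filter_upwards [h0] with n hn
  have hn' : (n : ℝ) ≠ 0 := by exact_mod_cast hn
  have hpos : 0 < (n : ℝ) ^ 2 := by positivity
  have h1 := hC (δ * n)
  rw [norm_mul]
  calc ‖a n‖ * ‖f (δ * n)‖ ≤ 1 * ‖f (δ * n)‖ := by gcongr; exact ha n
    _ ≤ C / δ ^ 2 * (1 / (n : ℝ) ^ 2) := by
      rw [one_mul, div_mul_div_comm, mul_one, le_div_iff₀ (by positivity)]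
      calc _ = (δ * n) ^ 2 * ‖f (δ * n)‖ := by ring
        _ ≤ C := h1

open FourierTransform in
lemma poisson_periodic (f f' f'' : ℝ → ℂ) (hf : ∀ x, HasDerivAt f (f' x) x)
    (hf' : ∀ x, HasDerivAt f' (f'' x) x) (i0 : Integrable f) (i1 : Integrable f')
    (i2 : Integrable f'') (C : ℝ) (hC : ∀ x, x ^ 2 * ‖f x‖ ≤ C) (δ : ℝ) (hδ : 0 < δ)
    (q : ℕ) [NeZero q] (a : ℤ → ℂ) (ha : ∀ n, ‖a n‖ ≤ 1) (hper : ∀ m n : ℤ, a (m * q + n) = a n)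
    (B : ℝ)
    (hB : ∀ k : ℤ, ‖∑ r : Fin q, a r * Complex.exp (2 * Real.pi * Complex.I * k *
      (((r : ℕ) : ℂ) / q))‖ ≤ B) :
    ‖∑' n : ℤ, a n * f (δ * n) - (∑ r : Fin q, a r) * ((q * δ)⁻¹ * ∫ x, f x)‖ ≤
      B * ((q * δ) * ∫ x, ‖f'' x‖) * C0 := by
  have hq : 0 < (q : ℝ) := by exact_mod_cast NeZero.pos q
  set L : ℝ := q * δ with hL
  have hLpos : 0 < L := by positivity
  set M := ∫ x, ‖f'' x‖ with hM
  have hM0 : 0 ≤ M := integral_nonneg fun x => norm_nonneg _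
  have hB0 : 0 ≤ B := (norm_nonneg _).trans (hB 0)
  set φ : ℝ → ℂ := fun x => f (L * x) with hφ
  have hlin : ∀ x : ℝ, HasDerivAt (fun x => L * x) L x := fun x => by
    simpa using (hasDerivAt_id x).const_mul L
  have dφ : ∀ x, HasDerivAt φ ((L : ℂ) * f' (L * x)) x := fun x => by
    have := (hf (L * x)).scomp x (hlin x)
    simpa [hφ, Function.comp_def] using this
  have dφ' : ∀ x, HasDerivAt (fun x => (L : ℂ) * f' (L * x)) ((L : ℂ) * ((L : ℂ) * f'' (L * x))) x :=
    fun x => by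
    have := ((hf' (L * x)).scomp x (hlin x)).const_mul (L : ℂ)
    simpa [Function.comp_def] using this
  have j0 : Integrable φ := i0.comp_mul_left' hLpos.ne'
  have j1 : Integrable (fun x => (L : ℂ) * f' (L * x)) :=
    (i1.comp_mul_left' hLpos.ne').const_mul _
  have j2 : Integrable (fun x => (L : ℂ) * ((L : ℂ) * f'' (L * x))) :=
    ((i2.comp_mul_left' hLpos.ne').const_mul _).const_mul _
  have hint2 : ∫ x, ‖(L : ℂ) * ((L : ℂ) * f'' (L * x))‖ = L * M := by
    simp only [norm_mul, Complex.norm_real, Real.norm_eq_abs, abs_of_pos hLpos]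
    rw [integral_const_mul, integral_const_mul,
      Measure.integral_comp_mul_left (fun x => ‖f'' x‖) L, abs_of_pos (inv_pos.2 hLpos), smul_eq_mul]
    field_simp
    rfl
  have hdec : ∀ k : ℤ, k ≠ 0 → ‖𝓕 φ k‖ ≤ L * M * (1 / (4 * π ^ 2 * (k : ℝ) ^ 2)) := by
    intro k hk
    have hk' : (k : ℝ) ≠ 0 := by exact_mod_cast hk
    have := fourier_decay φ _ _ dφ dφ' j0 j1 j2 k
    rw [hint2] at this
    have hp : 0 < 4 * π ^ 2 * (k : ℝ) ^ 2 := by positivity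
    rw [mul_one_div, le_div_iff₀ hp]
    linarith
  have hsF : Summable (fun k : ℤ => 𝓕 φ k) := by
    refine Summable.of_norm_bounded_eventually (summable_C0.mul_left (L * M)) ?_
    have h0 : ∀ᶠ n : ℤ in cofinite, n ≠ 0 := by
      simpa using (Set.finite_singleton (0 : ℤ)).compl_mem_cofinite
    filter_upwards [h0] with n hn
    exact hdec n hn
  have hcont : Continuous φ := continuous_iff_continuousAt.2 fun x => (dφ x).continuousAt
  have hO : φ =O[cocompact ℝ] fun x : ℝ => |x| ^ (-2 : ℝ) := by
    refine Asymptotics.IsBigO.of_bound (C / L ^ 2) ?_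
    have h0 : ∀ᶠ x : ℝ in cocompact ℝ, x ≠ 0 := by
      simpa using (isCompact_singleton (x := (0 : ℝ))).compl_mem_cocompact
    filter_upwards [h0] with x hx
    have h1 := hC (L * x)
    have hx2 : 0 < x ^ 2 := by positivity
    rw [Real.rpow_neg (abs_nonneg _), Real.rpow_two, sq_abs, norm_inv, Real.norm_eq_abs,
      abs_of_pos hx2, ← div_eq_mul_inv, div_div, le_div_iff₀ (by positivity)]
    calc _ = (L * x) ^ 2 * ‖f (L * x)‖ := by simp only [hφ]; ring
      _ ≤ C := h1
  have hpois := fun x => Real.tsum_eq_tsum_fourier_of_rpow_decay_of_summable hcont one_lt_two hO hsF x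
  -- reorganize the sum
  have hsum := summable_af f C hC δ hδ a ha
  have hsum2 : Summable (fun z : ℤ × Fin q => a (z.1 * q + z.2) * f (δ * (z.1 * q + z.2))) := by
    have := (Int.divModEquiv q).symm.summable_iff.2 hsum
    convert this using 2 with z
    simp [Int.divModEquiv]
  have hpart : ∀ r : Fin q, Summable (fun m : ℤ => a (m * q + r) * f (δ * (m * q + r))) := by
    intro r
    exact hsum2.comp_injective (i := fun m : ℤ => (m, r)) (fun a b h => by simpa using h)
  have e1 : ∑' n : ℤ, a n * f (δ * n) =
      ∑ r : Fin q, ∑' m : ℤ, a (m * q + r) * f (δ * (m * q + r)) := by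
    rw [← Summable.tsum_finsetSum (fun r _ => hpart r)]
    rw [← (Int.divModEquiv q).symm.tsum_eq]
    have : ∀ z : ℤ × Fin q, a ((Int.divModEquiv q).symm z) * f (δ * (((Int.divModEquiv q).symm z : ℤ) : ℝ))
       = a (z.1 * q + z.2) * f (δ * (z.1 * q + z.2)) := by
      intro z; simp [Int.divModEquiv]
    simp_rw [this]
    rw [Summable.tsum_prod hsum2]
    simp only [tsum_fintype]
  have e2 : ∀ r : Fin q, ∑' m : ℤ, a (m * q + r) * f (δ * (m * q + r)) =
      ∑' k : ℤ, a r * (𝓕 φ k * Complex.exp (2 * Real.pi * Complex.I * k * (((r : ℕ) : ℂ) / q))) := by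
    intro r
    have := hpois ((r : ℕ) / (q : ℝ))
    simp only [fourier_coe_apply] at this
    simp_rw [hper]
    rw [tsum_mul_left, tsum_mul_left]
    congr 1
    have t1 : ∀ m : ℤ, f (δ * (m * q + ((r : ℕ) : ℝ))) = φ ((r : ℕ) / (q : ℝ) + m) := by
      intro m
      change _ = f (L * _)
      congr 1
      rw [hL]
      field_simp
      ring
    have t2 : ∀ k : ℤ, Complex.exp (2 * Real.pi * Complex.I * k * (((r : ℕ) : ℂ) / q)) =
        Complex.exp (2 * π * Complex.I * k * (((r : ℕ) / (q : ℝ) : ℝ) : ℂ) / ((1 : ℝ) : ℂ)) := by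
      intro k
      congr 1
      push_cast
      ring
    simp_rw [t1, t2]
    exact this
  have hsk : ∀ r : Fin q, Summable (fun k : ℤ => a r * (𝓕 φ k *
      Complex.exp (2 * Real.pi * Complex.I * k * (((r : ℕ) : ℂ) / q)))) := by
    intro r
    refine Summable.mul_left _ (Summable.of_norm_bounded hsF.norm fun k => ?_)
    rw [norm_mul]
    have : ‖Complex.exp (2 * Real.pi * Complex.I * k * (((r : ℕ) : ℂ) / q))‖ = 1 := by
      rw [show (2 * Real.pi * Complex.I * k * (((r : ℕ) : ℂ) / q) : ℂ) =
        ((2 * Real.pi * k * ((r : ℕ) / q) : ℝ) : ℂ) * Complex.I by push_cast; ring]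
      exact Complex.norm_exp_ofReal_mul_I _
    rw [this, mul_one]
  set A : ℤ → ℂ := fun k => ∑ r : Fin q, a r * Complex.exp (2 * Real.pi * Complex.I * k *
      (((r : ℕ) : ℂ) / q)) with hA
  have e3 : ∑' n : ℤ, a n * f (δ * n) = ∑' k : ℤ, 𝓕 φ k * A k := by
    rw [e1, Finset.sum_congr rfl (fun r _ => e2 r), ← Summable.tsum_finsetSum (fun r _ => hsk r)]
    congr 1
    ext k
    simp only [hA, Finset.mul_sum]
    refine Finset.sum_congr rfl fun r _ => by ring
  have hsA : Summable (fun k : ℤ => 𝓕 φ k * A k) := by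
    refine Summable.of_norm_bounded (hsF.norm.mul_right B) fun k => ?_
    rw [norm_mul]
    gcongr
    exact hB k
  have e4 : 𝓕 φ ((0 : ℤ) : ℝ) * A 0 = (∑ r : Fin q, a r) * ((L : ℂ)⁻¹ * ∫ x, f x) := by
    have h1 : A 0 = ∑ r : Fin q, a r := by simp [hA]
    have h2 : 𝓕 φ ((0 : ℤ) : ℝ) = (L : ℂ)⁻¹ * ∫ x, f x := by
      rw [Real.fourier_real_eq_integral_exp_smul]
      simp only [Int.cast_zero, mul_zero, Complex.ofReal_zero, zero_mul, Complex.exp_zero, one_smul]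
      rw [hφ, Measure.integral_comp_mul_left f L, abs_of_pos (inv_pos.2 hLpos)]
      simp
    rw [h1, h2, mul_comm]
  rw [e3, hsA.tsum_eq_add_tsum_ite 0, e4]
  rw [Complex.ofReal_inv, add_sub_cancel_left]
  have hbd : ∀ k : ℤ, ‖if k = 0 then (0 : ℂ) else 𝓕 φ k * A k‖ ≤
      B * (L * M) * (1 / (4 * π ^ 2 * (k : ℝ) ^ 2)) := by
    intro k
    split_ifs with hk
    · rw [norm_zero]; positivity
    · rw [norm_mul]
      calc ‖𝓕 φ k‖ * ‖A k‖ ≤ (L * M * (1 / (4 * π ^ 2 * (k : ℝ) ^ 2))) * B := by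
            gcongr
            · exact hdec k hk
            · exact hB k
        _ = _ := by ring
  refine (tsum_of_norm_bounded (summable_C0.mul_left (B * (L * M))).hasSum hbd).trans ?_
  rw [tsum_mul_left]
  rfl

open SchwartzMap in
/-- `|x|^p u(x²)` -/
noncomputable def fA (p : ℝ) (u : 𝓢(ℝ, ℂ)) (x : ℝ) : ℂ := ((|x| ^ p : ℝ) : ℂ) * u (x ^ 2)

open SchwartzMap in
/-- `|x|^p x u(x²)` -/
noncomputable def fB (p : ℝ) (u : 𝓢(ℝ, ℂ)) (x : ℝ) : ℂ := ((|x| ^ p * x : ℝ) : ℂ) * u (x ^ 2)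

open SchwartzMap in
/-- derivative as a Schwartz function -/
noncomputable def sD (u : 𝓢(ℝ, ℂ)) : 𝓢(ℝ, ℂ) := SchwartzMap.derivCLM ℂ ℂ u

open SchwartzMap in
lemma sD_hasDerivAt (u : 𝓢(ℝ, ℂ)) (x : ℝ) : HasDerivAt u (sD u x) x := by
  simpa [sD] using u.differentiableAt.hasDerivAt

lemma abs_rpow_le_aux (p : ℝ) (hp : 0 ≤ p) (x : ℝ) : |x| ^ p ≤ 1 + (x ^ 2) ^ ⌈p⌉₊ := by
  rcases le_total |x| 1 with h | h
  · have : |x| ^ p ≤ 1 := Real.rpow_le_one (abs_nonneg _) h hp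
    have : 0 ≤ (x ^ 2) ^ ⌈p⌉₊ := by positivity
    linarith
  · have h1 : |x| ^ p ≤ |x| ^ (⌈p⌉₊ : ℝ) := Real.rpow_le_rpow_of_exponent_le h (Nat.le_ceil p)
    rw [Real.rpow_natCast] at h1
    have h2 : |x| ^ ⌈p⌉₊ ≤ (x ^ 2) ^ ⌈p⌉₊ := by
      rw [← sq_abs]
      gcongr
      nlinarith
    linarith

open SchwartzMap in
lemma fA_bdd (p : ℝ) (hp : 0 ≤ p) (u : 𝓢(ℝ, ℂ)) : ∃ C, 0 ≤ C ∧ ∀ x, ‖fA p u x‖ ≤ C := by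
  obtain ⟨C1, hC1, h1⟩ := u.decay 0 0
  obtain ⟨C2, hC2, h2⟩ := u.decay ⌈p⌉₊ 0
  refine ⟨C1 + C2, by positivity, fun x => ?_⟩
  have h1' := h1 (x ^ 2)
  have h2' := h2 (x ^ 2)
  simp only [pow_zero, one_mul, norm_iteratedFDeriv_zero, Real.norm_eq_abs,
    abs_of_nonneg (sq_nonneg x)] at h1' h2'
  rw [fA, norm_mul, Complex.norm_real, Real.norm_eq_abs, abs_of_nonneg (by positivity)]
  calc |x| ^ p * ‖u (x ^ 2)‖ ≤ (1 + (x ^ 2) ^ ⌈p⌉₊) * ‖u (x ^ 2)‖ := by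
        gcongr; exact abs_rpow_le_aux p hp x
    _ ≤ C1 + C2 := by linarith

lemma abs_rpow_add_two (p : ℝ) (hp : 0 ≤ p) (x : ℝ) : |x| ^ (p + 2) = x ^ 2 * |x| ^ p := by
  rw [Real.rpow_add_of_nonneg (abs_nonneg _) hp (by norm_num), Real.rpow_two, sq_abs, mul_comm]

open SchwartzMap in
lemma fA_decay (p : ℝ) (hp : 0 ≤ p) (u : 𝓢(ℝ, ℂ)) :
    ∃ C, 0 ≤ C ∧ ∀ x, x ^ 2 * ‖fA p u x‖ ≤ C := by
  obtain ⟨C, hC, h⟩ := fA_bdd (p + 2) (by linarith) u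
  refine ⟨C, hC, fun x => ?_⟩
  have := h x
  rw [fA, abs_rpow_add_two p hp, Complex.ofReal_mul, mul_assoc, norm_mul, Complex.norm_real,
    Real.norm_eq_abs, abs_of_nonneg (sq_nonneg x)] at this
  exact this

open SchwartzMap in
lemma fA_continuous (p : ℝ) (hp : 0 ≤ p) (u : 𝓢(ℝ, ℂ)) : Continuous (fA p u) := by
  unfold fA
  have h1 : Continuous fun x : ℝ => |x| ^ p := continuous_abs.rpow_const fun x => Or.inr hp
  have h2 : Continuous fun x : ℝ => u (x ^ 2) := u.continuous.comp (continuous_pow 2)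
  exact (Complex.continuous_ofReal.comp h1).mul h2

open SchwartzMap in
lemma fA_integrable (p : ℝ) (hp : 0 ≤ p) (u : 𝓢(ℝ, ℂ)) : Integrable (fA p u) := by
  obtain ⟨C1, hC1, h1⟩ := fA_bdd p hp u
  obtain ⟨C2, hC2, h2⟩ := fA_decay p hp u
  refine (integrable_inv_one_add_sq.const_mul (C1 + C2)).mono'
    (fA_continuous p hp u).aestronglyMeasurable (ae_of_all _ fun x => ?_)
  rw [← div_eq_mul_inv, le_div_iff₀ (by positivity)]
  linarith [h1 x, h2 x]

open SchwartzMap in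
lemma fB_integrable (p : ℝ) (hp : 0 ≤ p) (u : 𝓢(ℝ, ℂ)) : Integrable (fB p u) := by
  refine (fA_integrable (p + 1) (by linarith) u).norm.mono' ?_ (ae_of_all _ fun x => ?_)
  · refine Continuous.aestronglyMeasurable ?_
    have : fB p u = fun x : ℝ => (x : ℂ) * fA p u x := by
      ext x; simp only [fA, fB]; push_cast; ring
    rw [this]
    exact Complex.continuous_ofReal.mul (fA_continuous p hp u)
  · rw [fA, fB, norm_mul, norm_mul, Complex.norm_real, Complex.norm_real, norm_mul,
      Real.rpow_add_of_nonneg (abs_nonneg _) hp zero_le_one, Real.rpow_one, norm_mul]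
    simp

open SchwartzMap in
lemma comp_sq_hasDerivAt (u : 𝓢(ℝ, ℂ)) (x : ℝ) :
    HasDerivAt (fun x => u (x ^ 2)) (2 * (x : ℂ) * sD u (x ^ 2)) x := by
  have h1 : HasDerivAt (fun x : ℝ => x ^ 2) (2 * x) x := by simpa using hasDerivAt_pow 2 x
  have := (sD_hasDerivAt u (x ^ 2)).scomp x h1
  simpa [Function.comp_def] using this

open SchwartzMap in
lemma fA_hasDerivAt (p : ℝ) (hp : 2 ≤ p) (u : 𝓢(ℝ, ℂ)) (x : ℝ) :
    HasDerivAt (fA p u) (p * fB (p - 2) u x + 2 * fB p (sD u) x) x := by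
  have h := (hasDerivAt_abs_rpow x (p := p) (by linarith)).ofReal_comp.mul (comp_sq_hasDerivAt u x)
  convert! h using 1
  simp only [fB]
  push_cast
  ring

open SchwartzMap in
lemma fB_hasDerivAt (p : ℝ) (hp : 1 < p) (u : 𝓢(ℝ, ℂ)) (x : ℝ) :
    HasDerivAt (fB p u) ((p + 1) * fA p u x + 2 * fA (p + 2) (sD u) x) x := by
  have h0 := (hasDerivAt_abs_rpow x hp).mul (hasDerivAt_id x)
  have h := h0.ofReal_comp.mul (comp_sq_hasDerivAt u x)
  convert! h using 1
  have e : |x| ^ (p - 2) * x ^ 2 = |x| ^ p := by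
    rcases eq_or_ne x 0 with rfl | hx
    · simp [Real.zero_rpow (by linarith : p ≠ 0)]
    · rw [← sq_abs, ← Real.rpow_two, ← Real.rpow_add (abs_pos.2 hx)]; ring_nf
  have e' : ((|x| ^ (p - 2) : ℝ) : ℂ) * (x : ℂ) ^ 2 = ((|x| ^ p : ℝ) : ℂ) := by
    rw [← e]; push_cast; rfl
  simp only [fA, abs_rpow_add_two p (by linarith), id, Pi.mul_apply]
  push_cast
  linear_combination (-(p : ℂ) * u (x ^ 2)) * e'

open SchwartzMap in
/-- the constants attached to `f = |x|^p u(x²)` -/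
lemma fA_package (p : ℝ) (hp : 3 < p) (u : 𝓢(ℝ, ℂ)) : ∃ f' f'' : ℝ → ℂ,
    (∀ x, HasDerivAt (fA p u) (f' x) x) ∧ (∀ x, HasDerivAt f' (f'' x) x) ∧
    Integrable (fA p u) ∧ Integrable f' ∧ Integrable f'' := by
  refine ⟨fun x => p * fB (p - 2) u x + 2 * fB p (sD u) x,
    fun x => p * (((p - 2 : ℝ) + 1) * fA (p - 2) u x + 2 * fA (p - 2 + 2) (sD u) x) +
      2 * ((p + 1) * fA p (sD u) x + 2 * fA (p + 2) (sD (sD u)) x),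
    fA_hasDerivAt p (by linarith) u, fun x => ?_, fA_integrable p (by linarith) u, ?_, ?_⟩
  · exact ((fB_hasDerivAt (p - 2) (by linarith) u x).const_mul _).add
      ((fB_hasDerivAt p (by linarith) (sD u) x).const_mul _)
  · exact ((fB_integrable (p - 2) (by linarith) u).const_mul _).add
      ((fB_integrable p (by linarith) (sD u)).const_mul _)
  · exact ((((fA_integrable (p - 2) (by linarith) u).const_mul _).add
      ((fA_integrable (p - 2 + 2) (by linarith) _).const_mul _)).const_mul _).add
      ((((fA_integrable p (by linarith) _).const_mul _).add
      ((fA_integrable (p + 2) (by linarith) _).const_mul _)).const_mul _)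

open ProbabilityTheory in
lemma complex_gamma_integral (b : ℝ) (hb : 0 < b) (z : ℂ) (hz : 0 < z.re) :
    ∫ y in Ioi (0 : ℝ), ((y ^ (b - 1) : ℝ) : ℂ) * Complex.exp (-(z * y)) =
      Complex.Gamma b * z ^ (-b : ℂ) := by
  set μ : Measure ℝ := (volume.restrict (Ioi 0)).withDensity
    (fun y => ENNReal.ofReal (y ^ (b - 1))) with hμ
  have hmeas : Measurable (fun y : ℝ => ENNReal.ofReal (y ^ (b - 1))) := by fun_prop
  have hmgf : ∀ w : ℂ, complexMGF id μ w =
      ∫ y in Ioi (0 : ℝ), ((y ^ (b - 1) : ℝ) : ℂ) * Complex.exp (w * y) := by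
    intro w
    rw [complexMGF, hμ, integral_withDensity_eq_integral_toReal_smul hmeas
      (ae_of_all _ fun _ => ENNReal.ofReal_lt_top)]
    refine setIntegral_congr_fun measurableSet_Ioi fun y hy => ?_
    have hy' : (0 : ℝ) < y := hy
    simp only [id]
    rw [ENNReal.toReal_ofReal (by positivity), Complex.real_smul]
  have hset : Iio (0 : ℝ) ⊆ integrableExpSet id μ := by
    intro t ht
    have ht' : t < 0 := ht
    rw [integrableExpSet, Set.mem_ofPred_eq, hμ,
      integrable_withDensity_iff_integrable_smul' hmeas (ae_of_all _ fun _ => ENNReal.ofReal_lt_top)]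
    have := integrableOn_rpow_mul_exp_neg_mul_rpow (p := 1) (s := b - 1) (b := -t) (by linarith)
      one_pos (by linarith)
    refine IntegrableOn.congr_fun this (fun y hy => ?_) measurableSet_Ioi
    have hy' : (0 : ℝ) < y := hy
    simp only [id]
    rw [ENNReal.toReal_ofReal (by positivity)]
    simp
  have hsub : {w : ℂ | w.re < 0} ⊆ {w | w.re ∈ interior (integrableExpSet id μ)} := by
    intro w hw
    exact interior_maximal hset isOpen_Iio hw
  have han : AnalyticOnNhd ℂ (complexMGF id μ) {w : ℂ | w.re < 0} :=
    analyticOnNhd_complexMGF.mono hsub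
  have han2 : AnalyticOnNhd ℂ (fun w => Complex.Gamma b * (-w) ^ (-b : ℂ)) {w : ℂ | w.re < 0} := by
    refine DifferentiableOn.analyticOnNhd (fun w hw => ?_)
      (isOpen_lt Complex.continuous_re continuous_const)
    refine DifferentiableAt.differentiableWithinAt ?_
    refine DifferentiableAt.const_mul ?_ _
    refine DifferentiableAt.cpow (by fun_prop) (by fun_prop) ?_
    left
    simpa using hw
  have hreal : ∀ t : ℝ, t < 0 → complexMGF id μ t = Complex.Gamma b * (-(t : ℂ)) ^ (-b : ℂ) := by
    intro t ht
    rw [hmgf]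
    have := Complex.integral_cpow_mul_exp_neg_mul_Ioi (a := b) (r := -t) (by simpa using hb)
      (by linarith)
    rw [mul_comm, ← Complex.ofReal_neg, Complex.cpow_neg, ← Complex.inv_cpow, ← one_div, ← this]
    · refine setIntegral_congr_fun measurableSet_Ioi fun y hy => ?_
      have hy' : (0 : ℝ) < y := hy
      rw [Complex.ofReal_cpow hy'.le]
      push_cast
      simp
    · rw [Complex.arg_ofReal_of_nonneg (by linarith)]
      exact Real.pi_pos.ne
  have hpre : IsPreconnected {w : ℂ | w.re < 0} := (convex_halfSpace_re_lt 0).isPreconnected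
  have key := han.eqOn_of_preconnected_of_frequently_eq han2 hpre (z₀ := -1) (by simp) ?_
  · have := key (x := -z) (by simpa using hz)
    rw [hmgf] at this
    simpa using this
  · have ht : Tendsto (fun n : ℕ => (((-1 - 1 / ((n : ℝ) + 1)) : ℝ) : ℂ)) atTop
        (nhdsWithin (-1) {-1}ᶜ) := by
      refine tendsto_nhdsWithin_iff.2 ⟨?_, Eventually.of_forall fun n => ?_⟩
      · have : Tendsto (fun n : ℕ => ((-1 - 1 / ((n : ℝ) + 1)) : ℝ)) atTop (nhds (-1 - 0)) :=
          tendsto_const_nhds.sub tendsto_one_div_add_atTop_nhds_zero_nat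
        have h2 := (Complex.continuous_ofReal.tendsto _).comp this
        simpa [Function.comp_def] using h2
      · simp only [Set.mem_compl_iff, Set.mem_singleton_iff]
        intro h
        have h3 : (-1 - 1 / ((n : ℝ) + 1)) = -1 := by exact_mod_cast h
        have : 0 < 1 / ((n : ℝ) + 1) := by positivity
        linarith
    refine ht.frequently (Eventually.frequently (Eventually.of_forall fun n => ?_))
    refine hreal _ ?_
    have : 0 < 1 / ((n : ℝ) + 1) := by positivity
    linarith

lemma bump_gamma (χ : ℝ → ℝ) (hχ : Continuous χ) (hs : ∀ h, h ∉ Icc (1 : ℝ) 2 → χ h = 0)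
    (b : ℝ) (hb : 0 < b) (ε : ℝ) (hε : 0 < ε) :
    ∫ y in Ioi (0 : ℝ), ((Real.exp (-(ε * y)) : ℝ) : ℂ) * (((y ^ (b - 1) : ℝ) : ℂ) *
      ∫ h : ℝ, (χ h : ℂ) * Complex.exp (2 * π * Complex.I * y * h)) =
    ∫ h : ℝ, (χ h : ℂ) * (Complex.Gamma b * ((ε : ℂ) - 2 * π * Complex.I * h) ^ (-b : ℂ)) := by
  have hint : Integrable χ := hχ.integrable_of_hasCompactSupport
    (HasCompactSupport.intro isCompact_Icc hs)
  have h1 : ∀ y : ℝ, ((Real.exp (-(ε * y)) : ℝ) : ℂ) * (((y ^ (b - 1) : ℝ) : ℂ) *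
      ∫ h : ℝ, (χ h : ℂ) * Complex.exp (2 * π * Complex.I * y * h)) =
      ∫ h : ℝ, (((y ^ (b - 1) * Real.exp (-(ε * y)) : ℝ) : ℂ) * (χ h : ℂ)) *
        Complex.exp (2 * π * Complex.I * y * h) := by
    intro y
    rw [← integral_const_mul, ← integral_const_mul]
    congr 1
    ext h
    push_cast
    ring
  simp_rw [h1]
  have hg : Integrable (fun y : ℝ => ((y ^ (b - 1) * Real.exp (-(ε * y)) : ℝ) : ℂ))
      (volume.restrict (Ioi 0)) := by
    have := integrableOn_rpow_mul_exp_neg_mul_rpow (p := 1) (s := b - 1) (b := ε) (by linarith)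
      one_pos hε
    have h2 : Integrable (fun y : ℝ => y ^ (b - 1) * Real.exp (-(ε * y)))
        (volume.restrict (Ioi 0)) := by
      simpa [IntegrableOn] using this
    exact h2.ofReal
  rw [integral_integral_swap]
  · congr 1
    ext h
    rw [← complex_gamma_integral b hb _ (by simpa using hε), ← integral_const_mul]
    congr 1
    ext y
    rw [Complex.ofReal_mul, Complex.ofReal_exp]
    have : Complex.exp (-(((ε : ℂ) - 2 * π * Complex.I * h) * y)) =
      Complex.exp (((-(ε * y) : ℝ) : ℂ)) * Complex.exp (2 * π * Complex.I * y * h) := by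
      rw [← Complex.exp_add]
      congr 1
      push_cast
      ring
    rw [this]
    ring
  · have hp := hg.mul_prod (hint.ofReal (𝕜 := ℂ))
    refine hp.mul_bdd (c := 1) ?_ ?_
    · apply Continuous.aestronglyMeasurable
      fun_prop
    · refine ae_of_all _ fun z => ?_
      have : 2 * π * Complex.I * z.1 * z.2 = ((2 * π * z.1 * z.2 : ℝ) : ℂ) * Complex.I := by
        push_cast; ring
      simp only [this]
      rw [Complex.norm_exp_ofReal_mul_I]

open Complex in
lemma neg_two_pi_I_cpow (b h : ℝ) (hh : 0 < h) :
    (-(2 * π * I * h)) ^ (-b : ℂ) = (-(2 * π * I)) ^ (-b : ℂ) * ((h ^ (-b) : ℝ) : ℂ) := by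
  have h0 : (-(2 * (π:ℂ) * I)) ≠ 0 := by simp [Real.pi_ne_zero]
  have : -(2 * (π:ℂ) * I * h) = (h : ℂ) * (-(2 * π * I)) := by ring
  rw [this, ofReal_cpow hh.le, mul_comm (_ ^ _)]
  have hh0 : (h : ℂ) ≠ 0 := by exact_mod_cast hh.ne'
  rw [cpow_def_of_ne_zero (mul_ne_zero hh0 h0), log_ofReal_mul hh h0, cpow_def_of_ne_zero hh0,
    cpow_def_of_ne_zero h0, ← exp_add, ofReal_log hh.le]
  congr 1
  push_cast
  ring

lemma bump_mellin_ne (χ : ℝ → ℝ) (hχ : Continuous χ) (h0 : ∀ h, 0 ≤ χ h)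
    (hs : ∀ h, h ∉ Icc (1 : ℝ) 2 → χ h = 0) (h1 : χ (3/2) = 1)
    (b : ℝ) (hb : 0 < b) (V : ℝ → ℂ)
    (hV : ∀ y : ℝ, V y = ∫ h : ℝ, (χ h : ℂ) * Complex.exp (2 * π * Complex.I * y * h))
    (hint : IntegrableOn (fun y : ℝ => ((y ^ (b - 1) : ℝ) : ℂ) * V y) (Ioi 0)) :
    ∫ y in Ioi (0 : ℝ), ((y ^ (b - 1) : ℝ) : ℂ) * V y ≠ 0 := by
  have hχi : Integrable χ := hχ.integrable_of_hasCompactSupport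
    (HasCompactSupport.intro isCompact_Icc hs)
  have hε : Tendsto (fun n : ℕ => 1 / ((n : ℝ) + 1)) atTop (nhds 0) :=
    tendsto_one_div_add_atTop_nhds_zero_nat
  have lim1 : Tendsto (fun n : ℕ => ∫ y in Ioi (0 : ℝ),
      ((Real.exp (-((1 / ((n : ℝ) + 1)) * y)) : ℝ) : ℂ) * (((y ^ (b - 1) : ℝ) : ℂ) * V y)) atTop
      (nhds (∫ y in Ioi (0 : ℝ), ((y ^ (b - 1) : ℝ) : ℂ) * V y)) := by
    refine tendsto_integral_of_dominated_convergence (fun y => ‖((y ^ (b - 1) : ℝ) : ℂ) * V y‖)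
      ?_ hint.norm ?_ ?_
    · intro n
      refine AEStronglyMeasurable.mul ?_ hint.aestronglyMeasurable
      apply Continuous.aestronglyMeasurable
      fun_prop
    · intro n
      filter_upwards [ae_restrict_mem measurableSet_Ioi] with y hy
      have hy' : (0 : ℝ) < y := hy
      rw [norm_mul]
      refine mul_le_of_le_one_left (norm_nonneg _) ?_
      rw [Complex.norm_real, Real.norm_eq_abs, Real.abs_exp, Real.exp_le_one_iff]
      have : 0 < 1 / ((n : ℝ) + 1) := by positivity
      nlinarith
    · refine ae_of_all _ fun y => ?_
      have hc : Continuous fun ε : ℝ => ((Real.exp (-(ε * y)) : ℝ) : ℂ) *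
        (((y ^ (b - 1) : ℝ) : ℂ) * V y) := by fun_prop
      have := (hc.tendsto 0).comp hε
      simpa [Function.comp_def] using this
  have lim2 : Tendsto (fun n : ℕ => ∫ h : ℝ, (χ h : ℂ) *
      (Complex.Gamma b * (((1 / ((n : ℝ) + 1) : ℝ) : ℂ) - 2 * π * Complex.I * h) ^ (-b : ℂ))) atTop
      (nhds (∫ h : ℝ, (χ h : ℂ) * (Complex.Gamma b * (-(2 * π * Complex.I * h)) ^ (-b : ℂ)))) := by
    refine tendsto_integral_of_dominated_convergence (fun h => |χ h| * ‖Complex.Gamma b‖)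
      ?_ (hχi.norm.mul_const _) ?_ ?_
    · intro n
      apply Continuous.aestronglyMeasurable
      refine (Complex.continuous_ofReal.comp hχ).mul (continuous_const.mul ?_)
      refine Continuous.cpow (by fun_prop) continuous_const fun h => ?_
      left
      have : 0 < 1 / ((n : ℝ) + 1) := by positivity
      simp only [Complex.sub_re, Complex.ofReal_re]
      simp
      positivity
    · intro n
      refine ae_of_all _ fun h => ?_
      rw [norm_mul, norm_mul, Complex.norm_real, Real.norm_eq_abs]
      by_cases hh : h ∈ Icc (1 : ℝ) 2
      · gcongr
        refine mul_le_of_le_one_right (norm_nonneg _) ?_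
        have e0 : 0 < 1 / ((n : ℝ) + 1) := by positivity
        rw [← Complex.ofReal_neg, Complex.norm_cpow_real]
        refine Real.rpow_le_one_of_one_le_of_nonpos ?_ (by linarith)
        refine le_trans ?_ (Complex.abs_im_le_norm _)
        simp
        rw [abs_of_pos Real.pi_pos, abs_of_nonneg (by linarith [hh.1])]
        nlinarith [hh.1, Real.pi_gt_three]
      · simp [hs h hh]
    · refine ae_of_all _ fun h => ?_
      by_cases hh : h ∈ Icc (1 : ℝ) 2
      · refine Tendsto.const_mul _ (Tendsto.const_mul _ ?_)
        have hca : ContinuousAt (fun ε : ℝ => ((ε : ℂ) - 2 * π * Complex.I * h) ^ (-b : ℂ)) 0 := by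
          refine ContinuousAt.cpow (by fun_prop) continuousAt_const ?_
          right
          simp [Real.pi_ne_zero]
          linarith [hh.1]
        have := hca.tendsto.comp hε
        simpa [Function.comp_def] using this
      · simp [hs h hh]
  have heq : ∫ y in Ioi (0 : ℝ), ((y ^ (b - 1) : ℝ) : ℂ) * V y =
      ∫ h : ℝ, (χ h : ℂ) * (Complex.Gamma b * (-(2 * π * Complex.I * h)) ^ (-b : ℂ)) := by
    refine tendsto_nhds_unique lim1 (lim2.congr fun n => ?_)
    rw [← bump_gamma χ hχ hs b hb _ (by positivity)]
    simp_rw [hV]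
  have hcont : Continuous fun h : ℝ => χ h * h ^ (-b) := by
    have h3 : (fun h : ℝ => χ h * h ^ (-b)) = fun h : ℝ => χ h * (max h 1) ^ (-b) := by
      ext h
      by_cases hh : h ∈ Icc (1 : ℝ) 2
      · rw [max_eq_left hh.1]
      · simp [hs h hh]
    rw [h3]
    refine hχ.mul (Continuous.rpow_const (by fun_prop) fun h => ?_)
    left
    have : (1 : ℝ) ≤ max h 1 := le_max_right _ _
    linarith
  have heq2 : ∫ h : ℝ, (χ h : ℂ) * (Complex.Gamma b * (-(2 * π * Complex.I * h)) ^ (-b : ℂ)) =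
      (Complex.Gamma b * (-(2 * π * Complex.I)) ^ (-b : ℂ)) *
        ((∫ h : ℝ, χ h * h ^ (-b) : ℝ) : ℂ) := by
    rw [← integral_complex_ofReal, ← integral_const_mul]
    congr 1
    ext h
    by_cases hh : h ∈ Icc (1 : ℝ) 2
    · rw [neg_two_pi_I_cpow b h (by linarith [hh.1])]
      push_cast
      ring
    · simp [hs h hh]
  rw [heq, heq2]
  have hG : Complex.Gamma b ≠ 0 := Complex.Gamma_ne_zero_of_re_pos (by simpa using hb)
  have hc : (-(2 * (π : ℂ) * Complex.I)) ^ (-b : ℂ) ≠ 0 := by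
    rw [Ne, Complex.cpow_eq_zero_iff]
    simp [Real.pi_ne_zero]
  refine mul_ne_zero (mul_ne_zero hG hc) ?_
  rw [Complex.ofReal_ne_zero]
  refine ne_of_gt ?_
  have hnn : ∀ h, 0 ≤ χ h * h ^ (-b) := by
    intro h
    by_cases hh : h ∈ Icc (1 : ℝ) 2
    · have : 0 < h := by linarith [hh.1]
      have := h0 h
      positivity
    · simp [hs h hh]
  have hcs : HasCompactSupport (fun h : ℝ => χ h * h ^ (-b)) :=
    HasCompactSupport.intro (K := Icc 1 2) isCompact_Icc (fun h hh => by simp [hs h hh])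
  refine hcont.integral_pos_of_hasCompactSupport_nonneg_nonzero hcs hnn (x := 3/2) ?_
  rw [h1]
  positivity

open SchwartzMap in
lemma fA_integral (p : ℝ) (hp : 0 ≤ p) (V : 𝓢(ℝ, ℂ)) :
    IntegrableOn (fun y : ℝ => ((y ^ ((p + 1) / 2 - 1) : ℝ) : ℂ) * V y) (Ioi 0) ∧
    ∫ x, fA p V x = ∫ y in Ioi (0 : ℝ), ((y ^ ((p + 1) / 2 - 1) : ℝ) : ℂ) * V y := by
  have hi := fA_integrable p hp V
  have hpt : ∀ x ∈ Ioi (0 : ℝ), (((2 : ℝ) * x ^ ((2 : ℝ) - 1)) : ℝ) •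
      (fun y : ℝ => ((y ^ ((p + 1) / 2 - 1) : ℝ) : ℂ) * V y) (x ^ (2 : ℝ)) = 2 * fA p V x := by
    intro x hx
    have hx' : (0 : ℝ) < x := hx
    simp only
    rw [fA, Complex.real_smul, abs_of_pos hx', ← Real.rpow_mul hx'.le, Real.rpow_two,
      ← mul_assoc, ← Complex.ofReal_mul, mul_assoc 2, ← Real.rpow_add hx', ← mul_assoc]
    congr 1
    push_cast
    congr 3
    ring
  constructor
  · rw [← integrableOn_Ioi_comp_rpow_iff (p := 2) _ (by norm_num)]
    refine IntegrableOn.congr_fun (f := fun x => 2 * fA p V x) (hi.integrableOn.const_mul 2)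
      (fun x hx => ?_) measurableSet_Ioi
    rw [abs_of_pos two_pos]
    exact (hpt x hx).symm
  · rw [← integral_comp_rpow_Ioi_of_pos (p := 2) (by norm_num)]
    rw [setIntegral_congr_fun measurableSet_Ioi hpt, integral_const_mul]
    rw [← intervalIntegral.integral_Iic_add_Ioi (b := 0) hi.integrableOn hi.integrableOn]
    have : ∫ x in Iic (0 : ℝ), fA p V x = ∫ x in Ioi (0 : ℝ), fA p V x := by
      have h := integral_comp_neg_Iic 0 (fA p V)
      rw [neg_zero] at h
      rw [← h]
      congr 1
      ext x
      simp [fA]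
    rw [this]
    ring

open SchwartzMap FourierTransform in
lemma exists_bump : ∃ (χ : ℝ → ℝ) (ψ : ℝ → ℂ) (V : 𝓢(ℝ, ℂ)),
    Continuous χ ∧ (∀ h, 0 ≤ χ h) ∧ (∀ h, h ∉ Icc (1 : ℝ) 2 → χ h = 0) ∧ χ (3/2) = 1 ∧
    Continuous ψ ∧ (∀ h, h ∉ Icc (1 : ℝ) 2 → ψ h = 0) ∧
    (∀ y : ℝ, V y = ∫ h : ℝ, (χ h : ℂ) * Complex.exp (2 * π * Complex.I * y * h)) ∧
    (∀ y : ℝ, ∫ h : ℝ, ψ h * Complex.exp (2 * π * Complex.I * y * h) =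
      -(4 * π ^ 2 * (y : ℂ) ^ 2) * V y) := by
  let χ : ContDiffBump (3/2 : ℝ) := ⟨1/8, 1/4, by norm_num, by norm_num⟩
  have hcd : ContDiff ℝ ((⊤ : ℕ∞) : WithTop ℕ∞) (fun h : ℝ => ((χ h : ℝ) : ℂ)) :=
    Complex.ofRealCLM.contDiff.comp χ.contDiff
  have hcs : HasCompactSupport (fun h : ℝ => ((χ h : ℝ) : ℂ)) :=
    χ.hasCompactSupport.comp_left (g := fun x : ℝ => (x : ℂ)) (by simp)
  let X : 𝓢(ℝ, ℂ) := hcs.toSchwartzMap hcd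
  have hX : ∀ h, X h = ((χ h : ℝ) : ℂ) := fun h => rfl
  have hfour : ∀ (u : 𝓢(ℝ, ℂ)) (y : ℝ), ∫ h : ℝ, u h * Complex.exp (2 * π * Complex.I * y * h)
      = 𝓕 (u : ℝ → ℂ) (-y) := by
    intro u y
    rw [Real.fourier_real_eq_integral_exp_smul]
    congr 1
    ext h
    rw [smul_eq_mul, mul_comm]
    congr 2
    push_cast
    ring
  have hd : ∀ (u : 𝓢(ℝ, ℂ)) (y : ℝ), 𝓕 (sD u : ℝ → ℂ) (-y) = -(2 * π * Complex.I * y) * 𝓕 (u : ℝ → ℂ) (-y) := by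
    intro u y
    have h1 : (sD u : ℝ → ℂ) = deriv u := by
      ext x; exact (sD_hasDerivAt u x).deriv.symm
    have h2 := Real.fourier_deriv (f := u) u.integrable u.differentiable
      (by rw [← h1]; exact (sD u).integrable)
    rw [h1, h2]
    simp
  have hsD : ∀ (u : 𝓢(ℝ, ℂ)), tsupport (sD u) ⊆ tsupport u := by
    intro u
    have h1 : (sD u : ℝ → ℂ) = deriv u := by
      ext x; exact (sD_hasDerivAt u x).deriv.symm
    rw [h1]
    exact closure_minimal support_deriv_subset isClosed_closure
  have hballs : Metric.closedBall (3/2 : ℝ) (1/4) ⊆ Icc 1 2 := by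
    rw [Real.closedBall_eq_Icc]
    exact Icc_subset_Icc (by norm_num) (by norm_num)
  have hts : tsupport (X : ℝ → ℂ) ⊆ Icc 1 2 := by
    refine Subset.trans ?_ hballs
    have : Function.support (X : ℝ → ℂ) ⊆ Metric.ball (3/2 : ℝ) (1/4) := by
      rw [← χ.support_eq]
      intro h hh
      simpa [hX] using hh
    exact closure_minimal (this.trans Metric.ball_subset_closedBall) Metric.isClosed_closedBall
  refine ⟨χ, sD (sD X), 𝓕⁻ X, χ.continuous, fun h => χ.nonneg, ?_, ?_, (sD (sD X)).continuous,
    ?_, ?_, ?_⟩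
  · intro h hh
    have : X h = 0 := image_eq_zero_of_notMem_tsupport (fun h' => hh (hts h'))
    simpa [hX] using this
  · exact χ.one_of_mem_closedBall (Metric.mem_closedBall_self (by norm_num))
  · intro h hh
    exact image_eq_zero_of_notMem_tsupport (fun h' => hh (hts (hsD _ (hsD _ h'))))
  · intro y
    rw [SchwartzMap.fourierInv_coe, Real.fourierInv_eq_fourier_neg, ← hfour]
    rfl
  · intro y
    rw [hfour, hd, hd, SchwartzMap.fourierInv_coe, Real.fourierInv_eq_fourier_neg]
    linear_combination (4 * (π:ℂ) ^ 2 * (y : ℂ) ^ 2) * 𝓕 (X : ℝ → ℂ) (-y) * Complex.I_sq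

lemma ann_integral (H : ℝ) (hH : 0 < H) (D : ℝ → ℝ) :
    ∫ h, D h ∂ annMeasure H =
      (2 * H)⁻¹ * ∫ h in (Icc (-(2 * H)) (-H) ∪ Icc H (2 * H)), D h := by
  rw [annMeasure, integral_smul_measure, ENNReal.toReal_inv, ENNReal.toReal_ofReal (by positivity),
    smul_eq_mul]

lemma ann_prob (H : ℝ) (hH : 0 < H) : IsProbabilityMeasure (annMeasure H) := by
  constructor
  rw [annMeasure, Measure.smul_apply, Measure.restrict_apply_univ, measure_union _ measurableSet_Icc,
    Real.volume_Icc, Real.volume_Icc, ← ENNReal.ofReal_add (by linarith) (by linarith), smul_eq_mul,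
    show -H - -(2 * H) + (2 * H - H) = 2 * H by ring]
  · exact ENNReal.inv_mul_cancel (by simpa using hH) ENNReal.ofReal_ne_top
  · rw [Set.disjoint_left]
    intro x hx hx'
    linarith [hx.2, hx'.1]

lemma ann_integrable (H : ℝ) (hH : 0 < H) (D : ℝ → ℝ) (hD : Continuous D) :
    Integrable D (annMeasure H) := by
  refine Integrable.smul_measure ?_ (by simpa using hH)
  exact (hD.continuousOn.integrableOn_compact (isCompact_Icc.union isCompact_Icc))

lemma ann_jensen (H : ℝ) (hH : 0 < H) (D : ℝ → ℝ) (hD : Continuous D) :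
    ∫ h, D h ∂ annMeasure H ≤ Real.sqrt (∫ h, D h ^ 2 ∂ annMeasure H) := by
  have := ann_prob H hH
  refine Real.le_sqrt_of_sq_le ?_
  set m := ∫ h, D h ∂ annMeasure H with hm
  have h0 : 0 ≤ ∫ h, (D h - m) ^ 2 ∂ annMeasure H := integral_nonneg fun h => sq_nonneg _
  have h1 : ∫ h, (D h - m) ^ 2 ∂ annMeasure H = ∫ h, D h ^ 2 ∂ annMeasure H - m ^ 2 := by
    have : ∀ h, (D h - m) ^ 2 = D h ^ 2 - (2 * m * D h - m ^ 2) := fun h => by ring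
    simp_rw [this]
    rw [integral_sub (ann_integrable H hH _ (by fun_prop)) (ann_integrable H hH _ (by fun_prop)),
      integral_sub (ann_integrable H hH _ (by fun_prop)) (ann_integrable H hH _ (by fun_prop)),
      integral_const_mul, ← hm]
    simp
    ring
  linarith

lemma ann_dual (H : ℝ) (hH : 0 < H) (D : ℝ → ℂ) (hD : Continuous D) (ψ : ℝ → ℂ)
    (M : ℝ) (hM : ∀ t, ‖ψ t‖ ≤ M) (hs : ∀ t, t ∉ Icc (1 : ℝ) 2 → ψ t = 0) :
    ‖∫ t, D (H * t) * ψ t‖ ≤ 2 * M * Real.sqrt (∫ h, ‖D h‖ ^ 2 ∂ annMeasure H) := by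
  have hM0 : 0 ≤ M := (norm_nonneg _).trans (hM 0)
  have hcont : Continuous fun t : ℝ => M * ‖D (H * t)‖ := by fun_prop
  have h1 : ‖∫ t, D (H * t) * ψ t‖ ≤ ∫ t in Icc (1 : ℝ) 2, M * ‖D (H * t)‖ := by
    rw [← setIntegral_eq_integral_of_forall_compl_eq_zero (s := Icc (1 : ℝ) 2)
      (fun t ht => by rw [hs t ht, mul_zero])]
    refine norm_integral_le_of_norm_le (hcont.continuousOn.integrableOn_compact isCompact_Icc) ?_
    refine ae_of_all _ fun t => ?_
    rw [norm_mul, mul_comm]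
    gcongr
    exact hM t
  have h2 : ∫ t in Icc (1 : ℝ) 2, M * ‖D (H * t)‖ = M * (H⁻¹ * ∫ h in Icc H (2 * H), ‖D h‖) := by
    rw [integral_const_mul, integral_Icc_eq_integral_Ioc, integral_Icc_eq_integral_Ioc,
      ← intervalIntegral.integral_of_le (by norm_num), ← intervalIntegral.integral_of_le (by linarith),
      intervalIntegral.integral_comp_mul_left (fun h => ‖D h‖) hH.ne', smul_eq_mul, mul_one,
      mul_comm H 2]
  have h3 : ∫ h in Icc H (2 * H), ‖D h‖ ≤
      ∫ h in (Icc (-(2 * H)) (-H) ∪ Icc H (2 * H)), ‖D h‖ := by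
    refine setIntegral_mono_set
      (hD.norm.continuousOn.integrableOn_compact (isCompact_Icc.union isCompact_Icc))
      (ae_of_all _ fun h => norm_nonneg _) (ae_of_all _ subset_union_right)
  have h4 := ann_integral H hH (fun h => ‖D h‖)
  have h5 := ann_jensen H hH (fun h => ‖D h‖) hD.norm
  calc _ ≤ M * (H⁻¹ * ∫ h in Icc H (2 * H), ‖D h‖) := h1.trans h2.le
    _ ≤ M * (H⁻¹ * ∫ h in (Icc (-(2 * H)) (-H) ∪ Icc H (2 * H)), ‖D h‖) := by gcongr
    _ = 2 * M * ∫ h, ‖D h‖ ∂ annMeasure H := by rw [h4]; field_simp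
    _ ≤ _ := by gcongr

lemma FsN_continuous (s : ℝ) (N : ℕ) : Continuous (FsN s N) := by
  unfold FsN
  fun_prop

open SchwartzMap in
lemma FsN_pair (s : ℝ) (N : ℕ) (ψ : ℝ → ℂ) (V : 𝓢(ℝ, ℂ)) (hψ : Continuous ψ)
    (hsup : ∀ t, t ∉ Icc (1 : ℝ) 2 → ψ t = 0)
    (hV : ∀ y : ℝ, ∫ h : ℝ, ψ h * Complex.exp (2 * π * Complex.I * y * h) =
      -(4 * π ^ 2 * (y : ℂ) ^ 2) * V y) (x δ : ℝ) (hδ : 0 < δ) :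
    Integrable (fun t => FsN s N (x + δ ^ 2 * t) * ψ t) ∧
    ∫ t, FsN s N (x + δ ^ 2 * t) * ψ t = -(4 * π ^ 2 * ((δ ^ s : ℝ) : ℂ)) *
      ∑ n ∈ Finset.Icc 1 N, Complex.exp (2 * π * Complex.I * (n : ℂ) ^ 2 * (x : ℂ)) *
        fA (4 - s) V (δ * n) := by
  have hint : ∀ g : ℝ → ℂ, Continuous g → Integrable (fun t => g t * ψ t) := fun g hg =>
    (hg.mul hψ).integrable_of_hasCompactSupport
      (HasCompactSupport.intro (K := Icc 1 2) isCompact_Icc (fun h hh => by simp [hsup h hh]))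
  have hF := FsN_continuous s N
  refine ⟨hint (fun t => FsN s N (x + δ ^ 2 * t)) (by fun_prop), ?_⟩
  simp only [FsN, Finset.sum_mul]
  rw [integral_finsetSum _ fun n _ => hint _ (by fun_prop), Finset.mul_sum]
  refine Finset.sum_congr rfl fun n hn => ?_
  have hn0 : (0 : ℝ) < n := by exact_mod_cast (Finset.mem_Icc.1 hn).1
  have h1 : ∀ t : ℝ, (((n : ℝ) ^ (-s) : ℝ) : ℂ) *
      Complex.exp (2 * π * Complex.I * (n : ℂ) ^ 2 * ((x + δ ^ 2 * t : ℝ) : ℂ)) * ψ t =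
      ((((n : ℝ) ^ (-s) : ℝ) : ℂ) * Complex.exp (2 * π * Complex.I * (n : ℂ) ^ 2 * (x : ℂ))) *
      (ψ t * Complex.exp (2 * π * Complex.I * (((δ * n) ^ 2 : ℝ) : ℂ) * t)) := by
    intro t
    have : Complex.exp (2 * π * Complex.I * (n : ℂ) ^ 2 * ((x + δ ^ 2 * t : ℝ) : ℂ)) =
      Complex.exp (2 * π * Complex.I * (n : ℂ) ^ 2 * (x : ℂ)) *
      Complex.exp (2 * π * Complex.I * (((δ * n) ^ 2 : ℝ) : ℂ) * t) := by
      rw [← Complex.exp_add]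
      congr 1
      push_cast
      ring
    rw [this]
    ring
  simp_rw [h1]
  rw [integral_const_mul, hV, fA, abs_of_pos (by positivity)]
  have h2 : (n : ℝ) ^ (-s) * ((δ * n) ^ 2) ^ 2 = δ ^ s * (δ * n) ^ (4 - s) := by
    have e : (δ * (n : ℝ)) ^ (4 - s) = (δ * n) ^ 4 / (δ ^ s * (n : ℝ) ^ s) := by
      rw [Real.rpow_sub (by positivity), Real.mul_rpow hδ.le hn0.le (z := s)]
      congr 1
      exact_mod_cast Real.rpow_natCast (δ * n) 4
    rw [e, Real.rpow_neg hn0.le]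
    have : 0 < δ ^ s := by positivity
    have : 0 < (n : ℝ) ^ s := by positivity
    field_simp
  have h3 : (((n : ℝ) ^ (-s) : ℝ) : ℂ) * ((((δ * n) ^ 2 : ℝ) : ℂ)) ^ 2 =
      ((δ ^ s : ℝ) : ℂ) * (((δ * n) ^ (4 - s) : ℝ) : ℂ) := by
    exact_mod_cast congrArg (fun r : ℝ => (r : ℂ)) h2
  linear_combination (-(4 * (π : ℂ) ^ 2) * V ((δ * n) ^ 2) *
    Complex.exp (2 * π * Complex.I * (n : ℂ) ^ 2 * (x : ℂ))) * h3

lemma tail_bound (g : ℕ → ℂ) (C : ℝ) (hg : ∀ n : ℕ, 1 ≤ n → ‖g n‖ ≤ C * ((n : ℝ) ^ 2)⁻¹) (N : ℕ) :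
    ‖∑' n : ℕ, g (n + 1) - ∑ n ∈ Finset.Icc 1 N, g n‖ ≤ C * (2 / ((N : ℝ) + 1)) := by
  have hC : 0 ≤ C := by
    have := (norm_nonneg _).trans (hg 1 le_rfl)
    simpa using this
  have hsq : Summable (fun n : ℕ => C * ((n : ℝ) ^ 2)⁻¹) :=
    (Real.summable_nat_pow_inv.2 (by norm_num)).mul_left C
  have hsum : Summable (fun n : ℕ => g (n + 1)) := by
    refine Summable.of_norm_bounded ((summable_nat_add_iff 1).2 hsq) fun n => ?_
    exact hg (n + 1) (by omega)
  have h1 := hsum.sum_add_tsum_nat_add N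
  have h2 : ∑ n ∈ Finset.Icc 1 N, g n = ∑ i ∈ Finset.range N, g (i + 1) := by
    rw [Finset.range_eq_Ico, Finset.sum_Ico_add' g 0 N 1]
    rfl
  rw [h2, ← h1, add_sub_cancel_left]
  have hs2 : Summable (fun n : ℕ => C * (((n + N + 1 : ℕ) : ℝ) ^ 2)⁻¹) :=
    (summable_nat_add_iff (N + 1)).2 hsq
  refine (tsum_of_norm_bounded hs2.hasSum fun n => hg (n + N + 1) (by omega)).trans ?_
  rw [tsum_mul_left]
  gcongr
  refine Real.tsum_le_of_sum_range_le (fun n => by positivity) fun k => ?_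
  have h3 := sum_Ioo_inv_sq_le (α := ℝ) N (N + 1 + k)
  refine le_trans (le_of_eq ?_) h3
  have h4 : Finset.Ioo N (N + 1 + k) = Finset.Ico (0 + (N + 1)) (k + (N + 1)) := by
    ext x
    simp only [Finset.mem_Ioo, Finset.mem_Ico]
    omega
  rw [h4, ← Finset.sum_Ico_add', Finset.range_eq_Ico]
  rfl

open SchwartzMap in
lemma partial_sum (P : ℝ) (hP : 3 < P) (V : 𝓢(ℝ, ℂ)) :
    ∃ C : ℝ, 0 ≤ C ∧ ∀ (p : ℤ) (q : ℕ) [NeZero q], IsCoprime p (q : ℤ) → ∀ δ : ℝ, 0 < δ → ∀ N : ℕ, 0 < N →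
      ‖∑ n ∈ Finset.Icc 1 N, Complex.exp (2 * π * Complex.I * (n : ℂ) ^ 2 * (((p : ℝ) / q : ℝ) : ℂ)) *
        fA P V (δ * n) - 1 / 2 * (qGauss q p 0 * (((q : ℂ) * δ)⁻¹ * ∫ x, fA P V x))‖ ≤
      C * (Real.sqrt q * (q * δ)) + C * (δ ^ 2 * N)⁻¹ := by
  obtain ⟨f', f'', h1, h2, i0, i1, i2⟩ := fA_package P hP V
  obtain ⟨C, hC0, hC⟩ := fA_decay P (by linarith) V
  have hM0 : 0 ≤ ∫ x, ‖f'' x‖ := integral_nonneg fun x => norm_nonneg _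
  have hC00 : 0 ≤ C0 := tsum_nonneg fun k => by positivity
  refine ⟨Real.sqrt 2 * (∫ x, ‖f'' x‖) * C0 + 2 * C, by positivity, ?_⟩
  intro p q _ hpq δ hδ N h
  have hq : 0 < (q : ℝ) := by exact_mod_cast NeZero.pos q
  have hqc : (q : ℂ) ≠ 0 := by exact_mod_cast hq.ne'
  set a : ℤ → ℂ := fun n => Complex.exp (2 * π * Complex.I * (n : ℂ) ^ 2 * ((p : ℂ) / q)) with hadef
  have ha : ∀ n, ‖a n‖ = 1 := by
    intro n
    have : 2 * π * Complex.I * (n : ℂ) ^ 2 * ((p : ℂ) / q) =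
      ((2 * π * (n : ℝ) ^ 2 * (p / q) : ℝ) : ℂ) * Complex.I := by push_cast; ring
    rw [hadef]
    simp only [this]
    exact Complex.norm_exp_ofReal_mul_I _
  have hper : ∀ m n : ℤ, a (m * q + n) = a n := by
    intro m n
    rw [hadef]
    simp only
    rw [Complex.exp_eq_exp_iff_exists_int]
    refine ⟨p * (m ^ 2 * q + 2 * m * n), ?_⟩
    push_cast
    field_simp
    ring
  have hG : ∑ r : Fin q, a ((r : ℕ) : ℤ) = qGauss q p 0 := by
    rw [← qGauss_fin]
    refine Finset.sum_congr rfl fun r _ => ?_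
    simp [hadef]
  have hPo := poisson_periodic (fA P V) f' f'' h1 h2 i0 i1 i2 C hC δ hδ q a (fun n => (ha n).le)
    hper (Real.sqrt (2 * q)) (by
      intro k
      refine le_trans (le_of_eq ?_) (qGauss_le q p k hpq)
      rw [← qGauss_fin]
      simp [hadef])
  rw [hG] at hPo
  have hsum := summable_af (fA P V) C hC δ hδ a (fun n => (ha n).le)
  have heven : Function.Even (fun n : ℤ => a n * fA P V (δ * n)) := by
    intro n
    simp [hadef, fA]
  have hf0 : fA P V 0 = 0 := by
    rw [fA, abs_zero, Real.zero_rpow (by linarith)]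
    simp
  rw [tsum_int_eq_zero_add_two_mul_tsum_pnat heven hsum,
    tsum_pnat_eq_tsum_succ (f := fun n : ℕ => a ((n : ℕ) : ℤ) * fA P V (δ * ((n : ℕ) : ℤ)))] at hPo
  have ht := tail_bound (fun n : ℕ => a ((n : ℕ) : ℤ) * fA P V (δ * ((n : ℕ) : ℤ))) (C / δ ^ 2) (by
    intro n hn
    have hn0 : (0 : ℝ) < n := by exact_mod_cast hn
    rw [norm_mul, ha, one_mul]
    have := hC (δ * n)
    push_cast
    rw [← div_eq_mul_inv, div_div, le_div_iff₀ (by positivity)]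
    calc _ = (δ * n) ^ 2 * ‖fA P V (δ * n)‖ := by ring
      _ ≤ C := this) N
  simp only [Int.cast_zero, mul_zero, hf0, zero_add] at hPo
  set T := ∑' n : ℕ, a ((n + 1 : ℕ) : ℤ) * fA P V (δ * ((n + 1 : ℕ) : ℤ)) with hT
  set S := ∑ n ∈ Finset.Icc 1 N, a ((n : ℕ) : ℤ) * fA P V (δ * ((n : ℕ) : ℤ)) with hS
  have hSS : ∑ n ∈ Finset.Icc 1 N, Complex.exp (2 * π * Complex.I * (n : ℂ) ^ 2 *
      (((p : ℝ) / q : ℝ) : ℂ)) * fA P V (δ * n) = S := by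
    rw [hS]
    refine Finset.sum_congr rfl fun n _ => ?_
    simp [hadef]
  rw [hSS]
  have hcast : (((q * δ : ℝ)⁻¹ : ℝ) : ℂ) = ((q : ℂ) * δ)⁻¹ := by push_cast; rfl
  rw [hcast] at hPo
  set G := qGauss q p 0 * (((q : ℂ) * δ)⁻¹ * ∫ x, fA P V x) with hGdef
  have e1 : S - 1 / 2 * G = 1 / 2 * (2 • T - G) - (T - S) := by
    rw [two_nsmul]; ring
  rw [e1]
  have n1 : ‖1 / 2 * (2 • T - G)‖ ≤ 1 / 2 * (Real.sqrt (2 * q) * (q * δ * ∫ x, ‖f'' x‖) * C0) := by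
    rw [norm_mul]
    have : ‖(1 / 2 : ℂ)‖ = 1 / 2 := by simp
    rw [this]
    gcongr
  have n2 : C / δ ^ 2 * (2 / ((N : ℝ) + 1)) ≤ 2 * C * (δ ^ 2 * N)⁻¹ := by
    have hN : (0 : ℝ) < N := by exact_mod_cast h
    calc C / δ ^ 2 * (2 / ((N : ℝ) + 1)) ≤ C / δ ^ 2 * (2 / N) := by gcongr; linarith
      _ = _ := by field_simp
  refine (norm_sub_le _ _).trans ((add_le_add n1 (ht.trans n2)).trans ?_)
  rw [Real.sqrt_mul (by norm_num)]
  have p1 : 0 ≤ Real.sqrt 2 * (∫ x, ‖f'' x‖) * C0 := by positivity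
  have p2 : 0 ≤ Real.sqrt q * (q * δ) := by positivity
  have p3 : 0 ≤ (δ ^ 2 * N)⁻¹ := by positivity
  nlinarith [mul_nonneg p1 p2, mul_nonneg p1 p3, mul_nonneg hC0 p2]

lemma err_bound (H K δ : ℝ) (q N : ℕ) (hq : 1 ≤ q) (hK : 1 ≤ K) (hH : 0 < H)
    (hHK : H ≤ ((q : ℝ) ^ 2)⁻¹ / K) (hN : (H ^ 2)⁻¹ < (N : ℝ)) (hδ : 0 < δ) (h1 : H ≤ δ ^ 2)
    (h2 : δ ^ 2 ≤ 2 * H) :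
    δ * (Real.sqrt q * (q * δ)) + δ * (δ ^ 2 * N)⁻¹ ≤ 3 / K / Real.sqrt q := by
  have hq1 : (1 : ℝ) ≤ q := by exact_mod_cast hq
  have hq0 : (0 : ℝ) < q := by linarith
  have hN0 : (0 : ℝ) < N := lt_trans (by positivity) hN
  have hs0 : 0 < Real.sqrt q := Real.sqrt_pos.2 hq0
  have hss : Real.sqrt q * Real.sqrt q = q := Real.mul_self_sqrt hq0.le
  have hqHK : (q : ℝ) ^ 2 * H * K ≤ 1 := by
    rw [le_div_iff₀ (by linarith), ← one_div, le_div_iff₀ (by positivity)] at hHK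
    linarith
  have hH1 : H ≤ 1 := by
    refine hHK.trans ?_
    rw [div_le_one (by linarith)]
    refine le_trans ?_ hK
    exact inv_le_one_of_one_le₀ (by nlinarith)
  have a1 : δ * (Real.sqrt q * (q * δ)) ≤ 2 / K / Real.sqrt q := by
    rw [le_div_iff₀ hs0, le_div_iff₀ (by linarith)]
    calc δ * (Real.sqrt q * (q * δ)) * Real.sqrt q * K
        = (Real.sqrt q * Real.sqrt q) * q * K * δ ^ 2 := by ring
      _ = q * q * K * δ ^ 2 := by rw [hss]
      _ ≤ q * q * K * (2 * H) := by gcongr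
      _ = 2 * (q ^ 2 * H * K) := by ring
      _ ≤ 2 := by linarith
  have hδH : H ≤ δ := by
    by_contra hcon
    push Not at hcon
    nlinarith
  have a2 : δ * (δ ^ 2 * N)⁻¹ ≤ H := by
    have : δ * (δ ^ 2 * N)⁻¹ = 1 / (δ * N) := by field_simp
    rw [this, div_le_iff₀ (by positivity)]
    have h3 : 1 ≤ H ^ 2 * N := by
      rw [inv_lt_iff_one_lt_mul₀ (by positivity)] at hN
      linarith
    calc 1 ≤ H ^ 2 * N := h3
      _ = H * (H * N) := by ring
      _ ≤ H * (δ * N) := by gcongr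
  have a3 : H ≤ 1 / K / Real.sqrt q := by
    rw [le_div_iff₀ hs0, le_div_iff₀ (by linarith)]
    have : Real.sqrt q ≤ q ^ 2 := by
      have : Real.sqrt q ≤ q := Real.sqrt_le_iff.2 ⟨hq0.le, by nlinarith⟩
      nlinarith
    calc H * Real.sqrt q * K ≤ H * q ^ 2 * K := by gcongr
      _ ≤ 1 := by linarith
  calc _ ≤ 2 / K / Real.sqrt q + 1 / K / Real.sqrt q := add_le_add a1 (a2.trans a3)
    _ = _ := by ring

/-- lower bound near rationals with `q ≢ 2 (mod 4)`. For `1/2 < s < 1`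
there are constants `K ≥ 1` and `c > 0`, depending only on `s`, such that for all coprime
`p, q` with `q ≥ 1` and `q ≢ 2 (mod 4)`, all `0 < H ≤ q^{-2}/K` and all integers
`N > H^{-2}`:
`‖F_{s,N}(p/q + 2·) - F_{s,N}(p/q + ·)‖_{L²(μ̃_H)} ≥ c H^{(s-1)/2}/√q`. -/
theorem L2_lower_bound_near_rationals (s : ℝ) (hs : 1/2 < s) (hs' : s < 1) :
    ∃ K c : ℝ, 1 ≤ K ∧ 0 < c ∧
      ∀ (p : ℤ) (q : ℕ), 1 ≤ q → IsCoprime p (q : ℤ) → q % 4 ≠ 2 →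
        ∀ H : ℝ, 0 < H → H ≤ ((q : ℝ) ^ 2)⁻¹ / K →
          ∀ N : ℕ, (H ^ 2)⁻¹ < (N : ℝ) →
            c * H ^ ((s - 1) / 2) / Real.sqrt q ≤
              Real.sqrt (∫ h,
                ‖FsN s N ((p : ℝ) / q + 2 * h) - FsN s N ((p : ℝ) / q + h)‖ ^ 2
                  ∂ annMeasure H) := by
  obtain ⟨χ, ψ, V, hχ, hχ0, hχs, hχ1, hψ, hψs, hV, hψV⟩ := exists_bump
  obtain ⟨C, hC0, hC⟩ := partial_sum (4 - s) (by linarith) V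
  obtain ⟨M0, hM0⟩ := hψ.bounded_above_of_compact_support
    (HasCompactSupport.intro (K := Icc 1 2) isCompact_Icc hψs)
  set M := M0 + 1 with hMdef
  have hMpos : 0 < M := by linarith [(norm_nonneg _).trans (hM0 0)]
  have hM : ∀ t, ‖ψ t‖ ≤ M := fun t => by linarith [hM0 t]
  set J := ∫ x, fA (4 - s) V x with hJ
  have hJ0 : J ≠ 0 := by
    obtain ⟨hi, he⟩ := fA_integral (4 - s) (by linarith) V
    rw [hJ, he]
    exact bump_mellin_ne χ hχ hχ0 hχs hχ1 _ (by linarith) V hV hi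
  have hJpos : 0 < ‖J‖ := norm_pos_iff.2 hJ0
  set κ : ℝ := 1 - 2 ^ ((s - 1) / 2) with hκ
  have hκpos : 0 < κ := by
    have : (2 : ℝ) ^ ((s - 1) / 2) < 1 := Real.rpow_lt_one_of_one_lt_of_neg (by norm_num) (by linarith)
    linarith
  refine ⟨1 + 24 * C / (‖J‖ * κ), π ^ 2 * ‖J‖ * κ / (2 * M), ?_, by positivity, ?_⟩
  · have : 0 ≤ 24 * C / (‖J‖ * κ) := by positivity
    linarith
  set K : ℝ := 1 + 24 * C / (‖J‖ * κ) with hKdef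
  have hK1 : 1 ≤ K := by
    have : 0 ≤ 24 * C / (‖J‖ * κ) := by positivity
    linarith
  have hCK : 6 * C / K ≤ ‖J‖ * κ / 4 := by
    rw [div_le_iff₀ (by linarith), hKdef]
    have : ‖J‖ * κ / 4 * (1 + 24 * C / (‖J‖ * κ)) = ‖J‖ * κ / 4 + 6 * C := by
      field_simp
      ring
    rw [this]
    have : 0 < ‖J‖ * κ := by positivity
    linarith
  intro p q hq hpq hq4 H hH hHK N hN
  have : NeZero q := ⟨by omega⟩
  have hq1 : (1 : ℝ) ≤ q := by exact_mod_cast hq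
  have hq0 : (0 : ℝ) < q := by linarith
  have hs0 : 0 < Real.sqrt q := Real.sqrt_pos.2 hq0
  have hNpos : 0 < N := by
    have : (0 : ℝ) < N := lt_trans (by positivity) hN
    exact_mod_cast this
  set A : ℝ := H ^ ((s - 1) / 2) with hA
  have hApos : 0 < A := by positivity
  set x : ℝ := (p : ℝ) / q with hx
  set δ₁ := Real.sqrt H with hδ₁
  set δ₂ := Real.sqrt (2 * H) with hδ₂
  have d1 : 0 < δ₁ := Real.sqrt_pos.2 hH
  have d2 : 0 < δ₂ := Real.sqrt_pos.2 (by linarith)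
  have d1s : δ₁ ^ 2 = H := Real.sq_sqrt hH.le
  have d2s : δ₂ ^ 2 = 2 * H := Real.sq_sqrt (by linarith)
  have hA1 : δ₁ ^ (s - 1) = A := by
    rw [hδ₁, Real.sqrt_eq_rpow, ← Real.rpow_mul hH.le, hA]
    congr 1; ring
  have hA2 : δ₂ ^ (s - 1) = A * 2 ^ ((s - 1) / 2) := by
    rw [hδ₂, Real.sqrt_eq_rpow, ← Real.rpow_mul (by linarith), hA, mul_comm A,
      ← Real.mul_rpow (by norm_num) hH.le]
    congr 1; ring
  have hs1 : ∀ δ : ℝ, 0 < δ → δ ^ s = δ ^ (s - 1) * δ := by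
    intro δ hδ
    rw [Real.rpow_sub_one hδ.ne']
    field_simp
  obtain ⟨int1, pair1⟩ := FsN_pair s N ψ V hψ hψs hψV x δ₁ d1
  obtain ⟨int2, pair2⟩ := FsN_pair s N ψ V hψ hψs hψV x δ₂ d2
  have b1 := hC p q hpq δ₁ d1 N hNpos
  have b2 := hC p q hpq δ₂ d2 N hNpos
  have e1 := err_bound H K δ₁ q N hq hK1 hH hHK hN d1 d1s.ge (by linarith)
  have e2 := err_bound H K δ₂ q N hq hK1 hH hHK hN d2 (by linarith) d2s.le
  set S₁ := ∑ n ∈ Finset.Icc 1 N, Complex.exp (2 * π * Complex.I * (n : ℂ) ^ 2 * (x : ℂ)) *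
        fA (4 - s) V (δ₁ * n) with hS₁
  set S₂ := ∑ n ∈ Finset.Icc 1 N, Complex.exp (2 * π * Complex.I * (n : ℂ) ^ 2 * (x : ℂ)) *
        fA (4 - s) V (δ₂ * n) with hS₂
  set G := qGauss q p 0 with hG
  have hGge : Real.sqrt q ≤ ‖G‖ := qGauss_ge q p hpq hq4
  have hF := FsN_continuous s N
  have hdual := ann_dual H hH (fun h => FsN s N (x + 2 * h) - FsN s N (x + h)) (by fun_prop) ψ M hM
    hψs
  have hI : ∫ t, (FsN s N (x + 2 * (H * t)) - FsN s N (x + H * t)) * ψ t =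
      -(4 * π ^ 2) * (((δ₂ ^ s : ℝ) : ℂ) * S₂ - ((δ₁ ^ s : ℝ) : ℂ) * S₁) := by
    have : ∀ t : ℝ, (FsN s N (x + 2 * (H * t)) - FsN s N (x + H * t)) * ψ t =
        FsN s N (x + δ₂ ^ 2 * t) * ψ t - FsN s N (x + δ₁ ^ 2 * t) * ψ t := by
      intro t
      rw [d1s, d2s, mul_assoc, sub_mul]
    simp_rw [this]
    rw [integral_sub int2 int1, pair1, pair2]
    ring
  rw [hI] at hdual
  set R := Real.sqrt (∫ h, ‖FsN s N (x + 2 * h) - FsN s N (x + h)‖ ^ 2 ∂ annMeasure H) with hR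
  have hEb : ∀ (δ : ℝ) (S : ℂ), 0 < δ → δ ^ (s - 1) ≤ A →
      ‖S - 1 / 2 * (G * (((q : ℂ) * δ)⁻¹ * J))‖ ≤ C * (Real.sqrt q * (q * δ)) + C * (δ ^ 2 * N)⁻¹ →
      δ * (Real.sqrt q * (q * δ)) + δ * (δ ^ 2 * N)⁻¹ ≤ 3 / K / Real.sqrt q →
      ‖((δ ^ s : ℝ) : ℂ) * (S - 1 / 2 * (G * (((q : ℂ) * δ)⁻¹ * J)))‖ ≤
        A * (C * (3 / K / Real.sqrt q)) := by
    intro δ S hδ hδA hb he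
    rw [norm_mul, Complex.norm_real, Real.norm_eq_abs, abs_of_pos (by positivity), hs1 δ hδ,
      mul_assoc]
    have h1 : 0 ≤ δ * ‖S - 1 / 2 * (G * (((q : ℂ) * δ)⁻¹ * J))‖ := by positivity
    refine mul_le_mul hδA ?_ h1 hApos.le
    calc _ ≤ δ * (C * (Real.sqrt q * (q * δ)) + C * (δ ^ 2 * N)⁻¹) := by gcongr
      _ = C * (δ * (Real.sqrt q * (q * δ)) + δ * (δ ^ 2 * N)⁻¹) := by ring
      _ ≤ _ := by gcongr
  have E1 := hEb δ₁ S₁ d1 hA1.le b1 e1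
  have E2 := hEb δ₂ S₂ d2 (by rw [hA2]; nlinarith) b2 e2
  set Er₁ := ((δ₁ ^ s : ℝ) : ℂ) * (S₁ - 1 / 2 * (G * (((q : ℂ) * δ₁)⁻¹ * J))) with hEr₁
  set Er₂ := ((δ₂ ^ s : ℝ) : ℂ) * (S₂ - 1 / 2 * (G * (((q : ℂ) * δ₂)⁻¹ * J))) with hEr₂
  have hqc : (q : ℂ) ≠ 0 := by exact_mod_cast hq0.ne'
  have d1c : (δ₁ : ℂ) ≠ 0 := by exact_mod_cast d1.ne'
  have d2c : (δ₂ : ℂ) ≠ 0 := by exact_mod_cast d2.ne'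
  have hmain : ((A * κ / (2 * q) : ℝ) : ℂ) * (G * J) =
      (Er₂ - Er₁) - (((δ₂ ^ s : ℝ) : ℂ) * S₂ - ((δ₁ ^ s : ℝ) : ℂ) * S₁) := by
    have c1 : ((δ₁ ^ s : ℝ) : ℂ) = (A : ℂ) * δ₁ := by rw [hs1 δ₁ d1, hA1]; push_cast; rfl
    have c2 : ((δ₂ ^ s : ℝ) : ℂ) = (A : ℂ) * ((1 : ℂ) - κ) * δ₂ := by
      rw [hs1 δ₂ d2, hA2, show (2 : ℝ) ^ ((s - 1) / 2) = 1 - κ by rw [hκ]; ring]; push_cast; rfl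
    rw [hEr₁, hEr₂, c1, c2]
    push_cast
    field_simp
    ring
  have hn : ‖((A * κ / (2 * q) : ℝ) : ℂ) * (G * J)‖ = A * κ / (2 * q) * (‖G‖ * ‖J‖) := by
    rw [norm_mul, norm_mul, Complex.norm_real, Real.norm_eq_abs, abs_of_pos (by positivity)]
  have hlow : A * κ * ‖J‖ / 2 / Real.sqrt q ≤ A * κ / (2 * q) * (‖G‖ * ‖J‖) := by
    calc A * κ * ‖J‖ / 2 / Real.sqrt q = A * κ / (2 * q) * (Real.sqrt q * ‖J‖) := by
          have hss : Real.sqrt q * Real.sqrt q = q := Real.mul_self_sqrt hq0.le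
          have gen : ∀ r : ℝ, 0 < r →
              A * κ * ‖J‖ / 2 / r = A * κ / (2 * (r * r)) * (r * ‖J‖) := by
            intro r hr
            field_simp
          have h7 := gen _ hs0
          rwa [hss] at h7
      _ ≤ _ := by gcongr
  set W := ((δ₂ ^ s : ℝ) : ℂ) * S₂ - ((δ₁ ^ s : ℝ) : ℂ) * S₁ with hW
  have htri : A * κ / (2 * q) * (‖G‖ * ‖J‖) ≤ ‖Er₂‖ + ‖Er₁‖ + ‖W‖ := by
    rw [← hn, hmain]
    exact (norm_sub_le _ _).trans (add_le_add (norm_sub_le _ _) le_rfl)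
  have hWn : ‖-(4 * (π : ℂ) ^ 2) * W‖ = 4 * π ^ 2 * ‖W‖ := by
    rw [norm_mul]
    congr 1
    rw [norm_neg]
    have : (4 * (π : ℂ) ^ 2) = ((4 * π ^ 2 : ℝ) : ℂ) := by push_cast; rfl
    rw [this, Complex.norm_real, Real.norm_eq_abs, abs_of_pos (by positivity)]
  rw [hWn] at hdual
  have hEE : A * (C * (3 / K / Real.sqrt q)) + A * (C * (3 / K / Real.sqrt q)) ≤
      A * κ * ‖J‖ / 4 / Real.sqrt q := by
    calc _ = A * (6 * C / K) / Real.sqrt q := by ring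
      _ ≤ A * (‖J‖ * κ / 4) / Real.sqrt q := by gcongr
      _ = _ := by ring
  have hWlow : A * κ * ‖J‖ / 4 / Real.sqrt q ≤ ‖W‖ := by
    have : A * κ * ‖J‖ / 2 / Real.sqrt q = 2 * (A * κ * ‖J‖ / 4 / Real.sqrt q) := by ring
    linarith
  have hfin : 4 * π ^ 2 * (A * κ * ‖J‖ / 4 / Real.sqrt q) ≤ 2 * M * R :=
    le_trans (by gcongr) hdual
  calc π ^ 2 * ‖J‖ * κ / (2 * M) * A / Real.sqrt q
      = (4 * π ^ 2 * (A * κ * ‖J‖ / 4 / Real.sqrt q)) / (2 * M) := by ring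
    _ ≤ R := by
      rw [div_le_iff₀ (by positivity)]
      linarith
end
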